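/- arXiv:2111.04173 — 3 statements merged into one kernel-verified Lean document; each statement's English description precedes it below -/
import Mathlib

section
/- For any tripartite quantum state ρ_{SS'R}, the conditional mutual information I(S;S'|R) := S(S|R) + S(S'|R) - S(SS'|R) is nonnegative, where S(X|Y) = S(ρ_{XY}) - S(ρ_Y) is the conditional von Neumann entropy. -/
open Matrix BigOperators
open scoped Kronecker ComplexOrder

/-- von Neumann entropy via eigenvalues (junk value `0` for non-Hermitian matrices). -/
noncomputable def vN {n : Type*} [Fintype n] [DecidableEq n] (ρ : Matrix n n ℂ) : ℝ :=
  if h : ρ.IsHermitian then -∑ i, h.eigenvalues i * Real.log (h.eigenvalues i) else 0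

/-- A density operator: positive semidefinite, unit trace. -/
def IsDensity {n : Type*} [Fintype n] [DecidableEq n] (ρ : Matrix n n ℂ) : Prop :=
  ρ.PosSemidef ∧ ρ.trace = 1

/-- Partial trace over the second (right) tensor factor. -/
noncomputable def ptR {α β : Type*} [Fintype β] (ρ : Matrix (α × β) (α × β) ℂ) :
    Matrix α α ℂ :=
  Matrix.of fun i j => ∑ b, ρ (i, b) (j, b)

/-- Partial trace over the first (left) tensor factor. -/
noncomputable def ptL {α β : Type*} [Fintype α] (ρ : Matrix (α × β) (α × β) ℂ) :
    Matrix β β ℂ :=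
  Matrix.of fun a b => ∑ s, ρ (s, a) (s, b)

/-- Partial trace over the last factor of a tripartite state on `S ⊗ E ⊗ F`. -/
noncomputable def traceF {S E F : Type*} [Fintype F]
    (ρ : Matrix (S × E × F) (S × E × F) ℂ) : Matrix (S × E) (S × E) ℂ :=
  Matrix.of fun p q => ∑ f, ρ (p.1, (p.2, f)) (q.1, (q.2, f))

/-- Partial trace over the middle factor of a tripartite state on `S ⊗ E ⊗ F`. -/
noncomputable def traceE {S E F : Type*} [Fintype E]
    (ρ : Matrix (S × E × F) (S × E × F) ℂ) : Matrix (S × F) (S × F) ℂ :=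
  Matrix.of fun p q => ∑ e, ρ (p.1, (e, p.2)) (q.1, (e, q.2))

/-- Quantum mutual information `I(A;B) = S(ρ_A) + S(ρ_B) - S(ρ_AB)`. -/
noncomputable def MI {α β : Type*} [Fintype α] [Fintype β] [DecidableEq α] [DecidableEq β]
    (ρ : Matrix (α × β) (α × β) ℂ) : ℝ :=
  vN (ptR ρ) + vN (ptL ρ) - vN ρ

/-- Conditional mutual information `I(S;F|E) = S(SE) + S(EF) - S(SEF) - S(E)`. -/
noncomputable def cmiSFgE {S E F : Type*} [Fintype S] [Fintype E] [Fintype F]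
    [DecidableEq S] [DecidableEq E] [DecidableEq F]
    (σ : Matrix (S × E × F) (S × E × F) ℂ) : ℝ :=
  vN (traceF σ) + vN (ptL σ) - vN σ - vN (ptL (traceF σ))

/-- Conditional mutual information `I(S;E|F) = S(SF) + S(EF) - S(SEF) - S(F)`. -/
noncomputable def cmiSEgF {S E F : Type*} [Fintype S] [Fintype E] [Fintype F]
    [DecidableEq S] [DecidableEq E] [DecidableEq F]
    (σ : Matrix (S × E × F) (S × E × F) ℂ) : ℝ :=
  vN (traceE σ) + vN (ptL σ) - vN σ - vN (ptL (ptL σ))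

/-- Outer product `|v⟩⟨v|`. -/
noncomputable def outer {n : Type*} (v : n → ℂ) : Matrix n n ℂ :=
  Matrix.of fun i j => v i * star (v j)

open Filter Topology in
lemma ssa_scalar_tendsto {K : Type*} [Fintype K] (w a b : K → ℝ)
    (ha : ∀ k, w k ≠ 0 → 0 < a k) (hb : ∀ k, w k ≠ 0 → 0 < b k) :
    Tendsto (fun T : ℝ => ∑ k, w k * Real.log (b k + T * a k) - (∑ k, w k) * Real.log T) atTop
      (𝓝 (∑ k, w k * Real.log (a k))) := by
  have h1 : Tendsto (fun T : ℝ => ∑ k, w k * Real.log (b k * T⁻¹ + a k)) atTop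
      (𝓝 (∑ k, w k * Real.log (a k))) := by
    refine tendsto_finsetSum _ fun k _ => ?_
    by_cases hw : w k = 0
    · simp [hw]
    refine Tendsto.const_mul _ ?_
    refine Tendsto.log ?_ (ha k hw).ne'
    have := (tendsto_inv_atTop_zero (𝕜 := ℝ)).const_mul (b k) |>.add_const (a k)
    simpa using this
  refine h1.congr' ?_
  filter_upwards [eventually_gt_atTop 0] with T hT
  rw [Finset.sum_mul, ← Finset.sum_sub_distrib]
  refine Finset.sum_congr rfl fun k _ => ?_
  by_cases hw : w k = 0
  · simp [hw]
  have hA := ha k hw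
  have hB := hb k hw
  have : b k + T * a k = (b k * T⁻¹ + a k) * T := by field_simp
  rw [this, Real.log_mul (by positivity) hT.ne']
  ring

lemma ssa_scalar_deriv {K : Type*} [Fintype K] (w a b : K → ℝ)
    (ha : ∀ k, w k ≠ 0 → 0 < a k) (hb : ∀ k, w k ≠ 0 → 0 < b k) (t : ℝ) (ht : 0 ≤ t) :
    HasDerivAt (fun T : ℝ => ∑ k, w k * Real.log (b k + T * a k))
      (∑ k, w k * a k / (b k + t * a k)) t := by
  refine HasDerivAt.fun_sum fun k _ => ?_
  by_cases hw : w k = 0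
  · simpa [hw] using hasDerivAt_const t (0 : ℝ)
  have hA := ha k hw
  have hB := hb k hw
  have h0 : HasDerivAt (fun T : ℝ => b k + T * a k) (a k) t := by
    simpa using ((hasDerivAt_id t).mul_const (a k)).const_add (b k)
  have := (h0.log (by positivity)).const_mul (w k)
  simpa [mul_div_assoc] using this

open Filter Topology in
lemma ssa_scalar {K L : Type*} [Fintype K] [Fintype L] (w a b : K → ℝ) (w' a' b' : L → ℝ)
    (ha : ∀ k, w k ≠ 0 → 0 < a k) (hb : ∀ k, w k ≠ 0 → 0 < b k)
    (ha' : ∀ k, w' k ≠ 0 → 0 < a' k) (hb' : ∀ k, w' k ≠ 0 → 0 < b' k)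
    (hs : ∑ k, w k = ∑ k, w' k)
    (hF : ∀ t : ℝ, 0 < t →
      ∑ k, w' k * a' k / (b' k + t * a' k) ≤ ∑ k, w k * a k / (b k + t * a k)) :
    ∑ k, w k * Real.log (b k) - ∑ k, w' k * Real.log (b' k) ≤
      ∑ k, w k * Real.log (a k) - ∑ k, w' k * Real.log (a' k) := by
  set H : ℝ → ℝ := fun T => ∑ k, w k * Real.log (b k + T * a k) -
    ∑ k, w' k * Real.log (b' k + T * a' k) with hH
  have hmono : MonotoneOn H (Set.Ici 0) := by
    refine monotoneOn_of_hasDerivWithinAt_nonneg (convex_Ici 0) (f' := fun t =>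
      ∑ k, w k * a k / (b k + t * a k) - ∑ k, w' k * a' k / (b' k + t * a' k)) ?_ ?_ ?_
    · intro t ht
      exact ((ssa_scalar_deriv w a b ha hb t ht).sub
        (ssa_scalar_deriv w' a' b' ha' hb' t ht)).continuousAt.continuousWithinAt
    · intro t ht
      rw [interior_Ici] at ht
      exact ((ssa_scalar_deriv w a b ha hb t (le_of_lt ht)).sub
        (ssa_scalar_deriv w' a' b' ha' hb' t (le_of_lt ht))).hasDerivWithinAt
    · intro t ht
      rw [interior_Ici] at ht
      exact sub_nonneg.2 (hF t ht)
  have hlim : Tendsto H atTop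
      (𝓝 (∑ k, w k * Real.log (a k) - ∑ k, w' k * Real.log (a' k))) := by
    refine ((ssa_scalar_tendsto w a b ha hb).sub
      (ssa_scalar_tendsto w' a' b' ha' hb')).congr fun T => ?_
    simp only [hH, hs]; ring
  have h0 : H 0 = ∑ k, w k * Real.log (b k) - ∑ k, w' k * Real.log (b' k) := by
    simp [hH]
  rw [← h0]
  refine ge_of_tendsto hlim ?_
  filter_upwards [eventually_ge_atTop 0] with T hT
  exact hmono (Set.mem_Ici.2 le_rfl) hT hT

/-- The variational functional. -/
noncomputable def ssaPhi {n : Type*} [Fintype n] (t : ℝ) (ρ σ Y : Matrix n n ℂ) : ℝ :=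
  (2 * (Y * ρ).trace - (Y * Yᴴ * σ).trace - t * (Yᴴ * Y * ρ).trace).re

lemma ssaPhi_eq {n : Type*} [Fintype n] [DecidableEq n] (t : ℝ) (U V Z : Matrix n n ℂ)
    (p q : n → ℝ) (hU : Uᴴ * U = 1) (hV : Vᴴ * V = 1) :
    ssaPhi t (U * diagonal (fun i => (p i : ℂ)) * Uᴴ) (V * diagonal (fun i => (q i : ℂ)) * Vᴴ)
      (V * Z * Uᴴ) =
    ∑ k : n × n, (2 * (p k.1 * ((Uᴴ * V) k.1 k.2 * Z k.2 k.1).re) -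
      (q k.2 + t * p k.1) * Complex.normSq (Z k.2 k.1)) := by
  set P := diagonal (fun i => (p i : ℂ)) with hP
  set Q := diagonal (fun i => (q i : ℂ)) with hQ
  have e1 : (V * Z * Uᴴ * (U * P * Uᴴ)).trace = (Z * P * (Uᴴ * V)).trace := by
    have : V * Z * Uᴴ * (U * P * Uᴴ) = V * (Z * (Uᴴ * U) * P * Uᴴ) := by
      simp only [Matrix.mul_assoc]
    rw [this, hU, Matrix.trace_mul_comm]
    simp only [Matrix.mul_assoc, Matrix.one_mul]
  have e2 : (V * Z * Uᴴ * (V * Z * Uᴴ)ᴴ * (V * Q * Vᴴ)).trace = (Z * Zᴴ * Q).trace := by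
    have : V * Z * Uᴴ * (V * Z * Uᴴ)ᴴ * (V * Q * Vᴴ) =
        V * (Z * (Uᴴ * U) * Zᴴ * (Vᴴ * V) * Q * Vᴴ) := by
      simp only [Matrix.mul_assoc, Matrix.conjTranspose_mul, Matrix.conjTranspose_conjTranspose]
    rw [this, hU, hV, Matrix.trace_mul_comm]
    simp only [Matrix.mul_assoc, Matrix.one_mul, hV, Matrix.mul_one]
  have e3 : ((V * Z * Uᴴ)ᴴ * (V * Z * Uᴴ) * (U * P * Uᴴ)).trace = (Zᴴ * Z * P).trace := by
    have : (V * Z * Uᴴ)ᴴ * (V * Z * Uᴴ) * (U * P * Uᴴ) =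
        U * (Zᴴ * (Vᴴ * V) * Z * (Uᴴ * U) * P * Uᴴ) := by
      simp only [Matrix.mul_assoc, Matrix.conjTranspose_mul, Matrix.conjTranspose_conjTranspose]
    rw [this, hU, hV, Matrix.trace_mul_comm]
    simp only [Matrix.mul_assoc, Matrix.one_mul, hU, Matrix.mul_one]
  have f1 : (Z * P * (Uᴴ * V)).trace =
      ∑ k : n × n, (p k.1 : ℂ) * ((Uᴴ * V) k.1 k.2 * Z k.2 k.1) := by
    rw [Fintype.sum_prod_type_right]
    simp only [Matrix.trace, Matrix.diag, hP]
    refine Finset.sum_congr rfl fun j _ => ?_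
    rw [Matrix.mul_apply]
    refine Finset.sum_congr rfl fun i _ => ?_
    rw [Matrix.mul_diagonal]; ring
  have f2 : (Z * Zᴴ * Q).trace =
      ∑ k : n × n, ((q k.2 * Complex.normSq (Z k.2 k.1) : ℝ) : ℂ) := by
    rw [Fintype.sum_prod_type_right]
    simp only [Matrix.trace, Matrix.diag, hQ]
    refine Finset.sum_congr rfl fun j _ => ?_
    rw [Matrix.mul_diagonal, Matrix.mul_apply, Finset.sum_mul]
    refine Finset.sum_congr rfl fun i _ => ?_
    push_cast
    rw [Matrix.conjTranspose_apply, Complex.normSq_eq_conj_mul_self, starRingEnd_apply]; ring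
  have f3 : (Zᴴ * Z * P).trace =
      ∑ k : n × n, ((p k.1 * Complex.normSq (Z k.2 k.1) : ℝ) : ℂ) := by
    rw [Fintype.sum_prod_type]
    simp only [Matrix.trace, Matrix.diag, hP]
    refine Finset.sum_congr rfl fun j _ => ?_
    rw [Matrix.mul_diagonal, Matrix.mul_apply, Finset.sum_mul]
    refine Finset.sum_congr rfl fun i _ => ?_
    push_cast
    rw [Matrix.conjTranspose_apply, Complex.normSq_eq_conj_mul_self, starRingEnd_apply]; ring
  rw [ssaPhi, e1, e2, e3, f1, f2, f3]
  simp only [Finset.mul_sum, ← Finset.sum_sub_distrib, Complex.re_sum]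
  refine Finset.sum_congr rfl fun k _ => ?_
  generalize (Uᴴ * V) k.1 k.2 * Z k.2 k.1 = x
  simp only [← Complex.ofReal_mul, Complex.sub_re, Complex.ofReal_re, Complex.re_ofReal_mul]
  have : (2 * ((p k.1 : ℂ) * x)).re = 2 * (p k.1 * x.re) := by
    simp
  rw [this]
  ring

lemma ssaPhi_le {n : Type*} [Fintype n] [DecidableEq n] (t : ℝ) (ht : 0 < t) (U V Y : Matrix n n ℂ)
    (p q : n → ℝ) (hU : Uᴴ * U = 1) (hV : Vᴴ * V = 1) (hp : ∀ i, 0 ≤ p i) (hq : ∀ i, 0 ≤ q i) :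
    ssaPhi t (U * diagonal (fun i => (p i : ℂ)) * Uᴴ) (V * diagonal (fun i => (q i : ℂ)) * Vᴴ)
      Y ≤
    ∑ k : n × n, (Complex.normSq ((Uᴴ * V) k.1 k.2) * p k.1) * p k.1 / (q k.2 + t * p k.1) := by
  have hY : Y = V * (Vᴴ * Y * U) * Uᴴ := by
    have hU' := mul_eq_one_comm.1 hU
    have hV' := mul_eq_one_comm.1 hV
    calc Y = (V * Vᴴ) * Y * (U * Uᴴ) := by simp [hU', hV']
      _ = _ := by simp only [Matrix.mul_assoc]
  rw [hY, ssaPhi_eq t U V _ p q hU hV]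
  refine Finset.sum_le_sum fun k _ => ?_
  generalize (Vᴴ * Y * U) k.2 k.1 = z
  generalize (Uᴴ * V) k.1 k.2 = c
  have h1 := hp k.1
  have h2 := hq k.2
  rcases h1.eq_or_lt with h | h
  · rw [← h]; simp
    have := mul_nonneg h2 (Complex.normSq_nonneg z)
    linarith
  have hd : 0 < q k.2 + t * p k.1 := by positivity
  rw [le_div_iff₀ hd]
  generalize q k.2 + t * p k.1 = d at *
  generalize p k.1 = x at *
  simp only [Complex.normSq_apply, Complex.mul_re]
  nlinarith [sq_nonneg (d * z.re - x * c.re), sq_nonneg (d * z.im + x * c.im)]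

lemma ssaPhi_exists {n : Type*} [Fintype n] [DecidableEq n] (t : ℝ) (ht : 0 < t)
    (U V : Matrix n n ℂ)
    (p q : n → ℝ) (hU : Uᴴ * U = 1) (hV : Vᴴ * V = 1) (hp : ∀ i, 0 ≤ p i) (hq : ∀ i, 0 ≤ q i) :
    ∃ Y, ssaPhi t (U * diagonal (fun i => (p i : ℂ)) * Uᴴ)
      (V * diagonal (fun i => (q i : ℂ)) * Vᴴ) Y =
    ∑ k : n × n, (Complex.normSq ((Uᴴ * V) k.1 k.2) * p k.1) * p k.1 / (q k.2 + t * p k.1) := by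
  refine ⟨V * (Matrix.of fun j i => ((p i / (q j + t * p i) : ℝ) : ℂ) *
    star ((Uᴴ * V) i j)) * Uᴴ, ?_⟩
  rw [ssaPhi_eq t U V _ p q hU hV]
  refine Finset.sum_congr rfl fun k _ => ?_
  simp only [Matrix.of_apply]
  generalize (Uᴴ * V) k.1 k.2 = c
  have h1 := hp k.1
  have h2 := hq k.2
  rcases h1.eq_or_lt with h | h
  · rw [← h]; simp
  have hd : 0 < q k.2 + t * p k.1 := by positivity
  generalize q k.2 + t * p k.1 = d at *
  generalize p k.1 = x at *
  have : (c * (((x / d : ℝ) : ℂ) * star c)).re = x / d * Complex.normSq c := by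
    rw [mul_left_comm, Complex.re_ofReal_mul]
    congr 1
    simp [Complex.normSq_apply]
  rw [this, Complex.normSq_mul, Complex.normSq_ofReal]
  have : Complex.normSq (star c) = Complex.normSq c := Complex.normSq_conj c
  rw [this]
  field_simp
  ring

lemma ssa_ptL_mul_left {α β : Type*} [Fintype α] [Fintype β] [DecidableEq α]
    (A : Matrix β β ℂ) (M : Matrix (α × β) (α × β) ℂ) :
    ptL (((1 : Matrix α α ℂ) ⊗ₖ A) * M) = A * ptL M := by
  ext i j
  simp only [ptL, Matrix.of_apply, Matrix.mul_apply, Fintype.sum_prod_type,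
    Matrix.kroneckerMap_apply, Matrix.one_apply, ite_mul, one_mul, zero_mul, Finset.mul_sum]
  rw [Finset.sum_comm' (t' := Finset.univ) (s' := fun _ => Finset.univ) (by simp)]
  rw [Finset.sum_comm]
  simp
  rw [Finset.sum_comm]

lemma ssa_ptL_mul_right {α β : Type*} [Fintype α] [Fintype β] [DecidableEq α]
    (A : Matrix β β ℂ) (M : Matrix (α × β) (α × β) ℂ) :
    ptL (M * ((1 : Matrix α α ℂ) ⊗ₖ A)) = ptL M * A := by
  ext i j
  simp only [ptL, Matrix.of_apply, Matrix.mul_apply, Fintype.sum_prod_type,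
    Matrix.kroneckerMap_apply, Matrix.one_apply, ite_mul, one_mul, zero_mul, Finset.sum_mul,
    mul_ite, mul_zero]
  rw [Finset.sum_comm]
  simp
  rw [Finset.sum_comm]

lemma ssa_ptL_posSemidef {α β : Type*} [Fintype α] [Fintype β]
    (M : Matrix (α × β) (α × β) ℂ) (hM : M.PosSemidef) : (ptL M).PosSemidef := by
  have : ptL M = ∑ a, M.submatrix (fun b => (a, b)) (fun b => (a, b)) := by
    ext i j
    simp [ptL, Matrix.sum_apply]
  rw [this]
  exact Matrix.posSemidef_sum _ fun a _ => hM.submatrix _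

lemma ssa_traceE_posSemidef {S E F : Type*} [Fintype S] [Fintype E] [Fintype F]
    (M : Matrix (S × E × F) (S × E × F) ℂ) (hM : M.PosSemidef) : (traceE M).PosSemidef := by
  have : traceE M = ∑ e, M.submatrix (fun b : S × F => (b.1, e, b.2)) (fun b => (b.1, e, b.2)) := by
    ext i j
    simp [traceE, Matrix.sum_apply]
  rw [this]
  exact Matrix.posSemidef_sum _ fun a _ => hM.submatrix _

lemma ssa_spectral {n : Type*} [Fintype n] [DecidableEq n] (ρ : Matrix n n ℂ)
    (h : ρ.PosSemidef) : ∃ (U : Matrix n n ℂ) (p : n → ℝ), Uᴴ * U = 1 ∧ (∀ i, 0 ≤ p i) ∧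
      ρ = U * diagonal (fun i => (p i : ℂ)) * Uᴴ ∧ vN ρ = -∑ i, p i * Real.log (p i) := by
  refine ⟨h.1.eigenvectorUnitary, h.1.eigenvalues, ?_, h.eigenvalues_nonneg, ?_, ?_⟩
  · rw [← Matrix.star_eq_conjTranspose]
    exact Unitary.coe_star_mul_self _
  · have := h.1.spectral_theorem
    rw [Unitary.conjStarAlgAut_apply] at this
    exact this
  · rw [vN, dif_pos h.1]

lemma ssa_data {α β : Type*} [Fintype α] [Fintype β] [DecidableEq α] [DecidableEq β]
    (ρ : Matrix (α × β) (α × β) ℂ) (h : ρ.PosSemidef) :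
    ∃ (U V : Matrix (α × β) (α × β) ℂ) (p q : α × β → ℝ), Uᴴ * U = 1 ∧ Vᴴ * V = 1 ∧
      (∀ i, 0 ≤ p i) ∧ (∀ i, 0 ≤ q i) ∧
      ρ = U * diagonal (fun i => (p i : ℂ)) * Uᴴ ∧
      (1 : Matrix α α ℂ) ⊗ₖ ptL ρ = V * diagonal (fun i => (q i : ℂ)) * Vᴴ ∧
      (∀ k : (α × β) × (α × β), Complex.normSq ((Uᴴ * V) k.1 k.2) * p k.1 ≠ 0 → 0 < p k.1) ∧
      (∀ k : (α × β) × (α × β), Complex.normSq ((Uᴴ * V) k.1 k.2) * p k.1 ≠ 0 → 0 < q k.2) ∧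
      (∑ k : (α × β) × (α × β), Complex.normSq ((Uᴴ * V) k.1 k.2) * p k.1 = ρ.trace.re) ∧
      (∑ k : (α × β) × (α × β), Complex.normSq ((Uᴴ * V) k.1 k.2) * p k.1 * Real.log (p k.1)
        = - vN ρ) ∧
      (∑ k : (α × β) × (α × β), Complex.normSq ((Uᴴ * V) k.1 k.2) * p k.1 * Real.log (q k.2)
        = - vN (ptL ρ)) := by
  obtain ⟨U, p, hU, hp, hρ, hS⟩ := ssa_spectral ρ h
  obtain ⟨V, q, hV, hq, hτ, hT⟩ := ssa_spectral (ptL ρ) (ssa_ptL_posSemidef ρ h)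
  have hVV : ((1 : Matrix α α ℂ) ⊗ₖ V)ᴴ * ((1 : Matrix α α ℂ) ⊗ₖ V) = 1 := by
    rw [Matrix.conjTranspose_kronecker, ← Matrix.mul_kronecker_mul, hV]
    simp
  set V₂ := (1 : Matrix α α ℂ) ⊗ₖ V with hV₂
  set W := Uᴴ * V₂ with hW
  have hrow : ∀ i, ∑ j, Complex.normSq (W i j) = 1 := by
    intro i
    have h1 : W * Wᴴ = 1 := by
      have hU' := mul_eq_one_comm.1 hVV
      rw [hW, Matrix.conjTranspose_mul, Matrix.conjTranspose_conjTranspose]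
      calc Uᴴ * V₂ * (V₂ᴴ * U) = Uᴴ * (V₂ * V₂ᴴ) * U := by simp only [Matrix.mul_assoc]
        _ = 1 := by rw [hU', Matrix.mul_one, hU]
    have h2 := congrFun (congrFun h1 i) i
    rw [Matrix.mul_apply, Matrix.one_apply_eq] at h2
    have h3 : ((∑ j, Complex.normSq (W i j) : ℝ) : ℂ) = 1 := by
      rw [← h2]
      push_cast
      refine Finset.sum_congr rfl fun j _ => ?_
      rw [Matrix.conjTranspose_apply, Complex.normSq_eq_conj_mul_self, starRingEnd_apply, mul_comm]
    exact_mod_cast h3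
  have hcol : ∀ j, ((∑ i, Complex.normSq (W i j) * p i : ℝ) : ℂ) = (V₂ᴴ * ρ * V₂) j j := by
    intro j
    have h1 : V₂ᴴ * ρ * V₂ = Wᴴ * diagonal (fun i => (p i : ℂ)) * W := by
      rw [hW, hρ, Matrix.conjTranspose_mul, Matrix.conjTranspose_conjTranspose]
      simp only [Matrix.mul_assoc]
    rw [h1, Matrix.mul_apply]
    push_cast
    refine Finset.sum_congr rfl fun i _ => ?_
    rw [Matrix.mul_diagonal, Matrix.conjTranspose_apply, Complex.normSq_eq_conj_mul_self,
      starRingEnd_apply]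
    ring
  have hq_eq : ∀ b, ∑ a, ∑ i, Complex.normSq (W i (a, b)) * p i = q b := by
    intro b
    have h1 : ptL (V₂ᴴ * ρ * V₂) = diagonal (fun i => (q i : ℂ)) := by
      rw [ssa_ptL_mul_right, hV₂, Matrix.conjTranspose_kronecker, Matrix.conjTranspose_one,
        ssa_ptL_mul_left, hτ]
      calc Vᴴ * (V * diagonal (fun i => (q i : ℂ)) * Vᴴ) * V
          = (Vᴴ * V) * diagonal (fun i => (q i : ℂ)) * (Vᴴ * V) := by
            simp only [Matrix.mul_assoc]
        _ = _ := by rw [hV]; simp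
    have h2 := congrFun (congrFun h1 b) b
    rw [Matrix.diagonal_apply_eq, ptL, Matrix.of_apply] at h2
    have h3 : ((∑ a, ∑ i, Complex.normSq (W i (a, b)) * p i : ℝ) : ℂ) = (q b : ℂ) := by
      rw [← h2, Complex.ofReal_sum]
      exact Finset.sum_congr rfl fun a _ => hcol (a, b)
    exact_mod_cast h3
  have hnn : ∀ i j, 0 ≤ Complex.normSq (W i j) * p i :=
    fun i j => mul_nonneg (Complex.normSq_nonneg _) (hp i)
  refine ⟨U, V₂, p, fun k => q k.2, hU, hVV, hp, fun k => hq k.2, hρ, ?_, ?_, ?_, ?_, ?_, ?_⟩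
  · conv_lhs => rw [hτ]
    have : diagonal (fun k : α × β => (q k.2 : ℂ)) =
        (1 : Matrix α α ℂ) ⊗ₖ diagonal (fun i => (q i : ℂ)) := by
      rw [← Matrix.diagonal_one, Matrix.diagonal_kronecker_diagonal]
      simp
    rw [this, hV₂, Matrix.conjTranspose_kronecker, ← Matrix.mul_kronecker_mul,
      ← Matrix.mul_kronecker_mul]
    simp
  · intro k hk
    exact lt_of_le_of_ne (hp _) fun h0 => hk (by rw [← h0, mul_zero])
  · intro k hk
    have h1 : 0 < Complex.normSq (W k.1 k.2) * p k.1 := lt_of_le_of_ne (hnn _ _) (Ne.symm hk)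
    refine lt_of_lt_of_le h1 ?_
    show _ ≤ q k.2.2
    rw [← hq_eq k.2.2]
    refine le_trans ?_ (Finset.single_le_sum (f := fun a => ∑ i, Complex.normSq (W i (a, k.2.2)) * p i)
      (fun a _ => Finset.sum_nonneg fun i _ => hnn i _) (Finset.mem_univ k.2.1))
    exact Finset.single_le_sum (f := fun i => Complex.normSq (W i (k.2.1, k.2.2)) * p i)
      (fun i _ => hnn i _) (Finset.mem_univ k.1)
  · have htr : ρ.trace = ((∑ i, p i : ℝ) : ℂ) := by
      rw [hρ, Matrix.trace_mul_comm, ← Matrix.mul_assoc, hU, Matrix.one_mul,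
        Matrix.trace_diagonal]
      push_cast
      rfl
    rw [htr, Complex.ofReal_re, Fintype.sum_prod_type]
    refine Finset.sum_congr rfl fun i _ => ?_
    show ∑ j, Complex.normSq (W i j) * p i = p i
    rw [← Finset.sum_mul, hrow, one_mul]
  · rw [hS, neg_neg, Fintype.sum_prod_type]
    refine Finset.sum_congr rfl fun i _ => ?_
    simp only [mul_assoc]
    rw [← Finset.sum_mul, hrow, one_mul]
  · rw [hT, neg_neg, Fintype.sum_prod_type_right, Fintype.sum_prod_type_right]
    refine Finset.sum_congr rfl fun b _ => ?_
    simp only [← Finset.sum_mul]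
    rw [hq_eq]

/-- Ampliation `Y ⊗ 1` on the middle factor. -/
def ssaHat {S E F : Type*} [DecidableEq E] (Y : Matrix (S × F) (S × F) ℂ) :
    Matrix (S × E × F) (S × E × F) ℂ :=
  Matrix.of fun x y => if x.2.1 = y.2.1 then Y (x.1, x.2.2) (y.1, y.2.2) else 0

lemma ssaHat_mul {S E F : Type*} [Fintype S] [Fintype E] [Fintype F] [DecidableEq E]
    (Y Z : Matrix (S × F) (S × F) ℂ) :
    (ssaHat (Y * Z) : Matrix (S × E × F) (S × E × F) ℂ) = ssaHat Y * ssaHat Z := by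
  ext ⟨s, e, f⟩ ⟨s', e', f'⟩
  simp only [ssaHat, Matrix.of_apply, Matrix.mul_apply, Fintype.sum_prod_type]
  by_cases h : e = e'
  · subst h
    simp only [if_true, ite_mul, zero_mul]
    refine Finset.sum_congr rfl fun a _ => ?_
    rw [Finset.sum_comm]
    simp
  · simp only [if_neg h]
    symm
    refine Finset.sum_eq_zero fun a _ => Finset.sum_eq_zero fun b _ =>
      Finset.sum_eq_zero fun c _ => ?_
    by_cases hb : e = b
    · subst hb; simp [h]
    · simp [hb]

lemma ssaHat_conjTranspose {S E F : Type*} [DecidableEq E] (Y : Matrix (S × F) (S × F) ℂ) :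
    (ssaHat Yᴴ : Matrix (S × E × F) (S × E × F) ℂ) = (ssaHat Y)ᴴ := by
  ext ⟨s, e, f⟩ ⟨s', e', f'⟩
  simp only [ssaHat, Matrix.of_apply, Matrix.conjTranspose_apply]
  by_cases h : e = e'
  · simp [h]
  · simp [h, Ne.symm h]

lemma ssaHat_trace {S E F : Type*} [Fintype S] [Fintype E] [Fintype F] [DecidableEq E]
    (Y : Matrix (S × F) (S × F) ℂ) (M : Matrix (S × E × F) (S × E × F) ℂ) :
    (ssaHat Y * M).trace = (Y * traceE M).trace := by
  simp only [Matrix.trace, Matrix.diag, Fintype.sum_prod_type]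
  refine Finset.sum_congr rfl fun s _ => ?_
  rw [Finset.sum_comm]
  refine Finset.sum_congr rfl fun f _ => ?_
  simp only [ssaHat, traceE, Matrix.mul_apply, Matrix.of_apply, Fintype.sum_prod_type,
    ite_mul, zero_mul, Finset.mul_sum]
  rw [Finset.sum_comm]
  refine Finset.sum_congr rfl fun s' _ => ?_
  rw [Finset.sum_comm' (t' := Finset.univ) (s' := fun _ => Finset.univ) (by simp)]
  conv_rhs => rw [Finset.sum_comm]
  refine Finset.sum_congr rfl fun e _ => ?_
  rw [Finset.sum_comm]
  simp

lemma ssaPhi_hat {S E F : Type*} [Fintype S] [Fintype E] [Fintype F] [DecidableEq E] (t : ℝ)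
    (ρ σ : Matrix (S × E × F) (S × E × F) ℂ) (Y : Matrix (S × F) (S × F) ℂ) :
    ssaPhi t ρ σ (ssaHat Y) = ssaPhi t (traceE ρ) (traceE σ) Y := by
  simp only [ssaPhi, ← ssaHat_conjTranspose, ← ssaHat_mul, ssaHat_trace]

lemma ssa_traceE_kron {S E F : Type*} [Fintype E] [DecidableEq S]
    (τ : Matrix (E × F) (E × F) ℂ) :
    traceE ((1 : Matrix S S ℂ) ⊗ₖ τ) = (1 : Matrix S S ℂ) ⊗ₖ ptL τ := by
  ext i j
  simp [traceE, ptL, Finset.mul_sum]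

lemma ssa_ptL_traceE {S E F : Type*} [Fintype S] [Fintype E]
    (ρ : Matrix (S × E × F) (S × E × F) ℂ) : ptL (traceE ρ) = ptL (ptL ρ) := by
  ext i j
  simp only [traceE, ptL, Matrix.of_apply]
  exact Finset.sum_comm

lemma ssa_trace_traceE {S E F : Type*} [Fintype S] [Fintype E] [Fintype F]
    (ρ : Matrix (S × E × F) (S × E × F) ℂ) : (traceE ρ).trace = ρ.trace := by
  simp only [traceE, Matrix.trace, Matrix.diag, Matrix.of_apply, Fintype.sum_prod_type]
  exact Finset.sum_congr rfl fun s _ => Finset.sum_comm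

/-- Strong subadditivity: nonnegativity of conditional mutual information
`I(S;S'|R) = S(S|R) + S(S'|R) - S(SS'|R) ≥ 0` for any tripartite density operator. -/
theorem stmt0 {S S' R : Type*} [Fintype S] [Fintype S'] [Fintype R]
    [DecidableEq S] [DecidableEq S'] [DecidableEq R]
    (ρ : Matrix (S × S' × R) (S × S' × R) ℂ) (hρ : IsDensity ρ) :
    0 ≤ cmiSEgF ρ := by
  obtain ⟨U, V, p, q, hU, hV, hp, hq, e1, e2, h1, h2, h3, h4, h5⟩ := ssa_data ρ hρ.1
  obtain ⟨U', V', p', q', hU', hV', hp', hq', e1', e2', h1', h2', h3', h4', h5'⟩ :=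
    ssa_data (traceE ρ) (ssa_traceE_posSemidef ρ hρ.1)
  have key := ssa_scalar
    (fun k : (S × S' × R) × (S × S' × R) => Complex.normSq ((Uᴴ * V) k.1 k.2) * p k.1)
    (fun k => p k.1) (fun k => q k.2)
    (fun k : (S × R) × (S × R) => Complex.normSq ((U'ᴴ * V') k.1 k.2) * p' k.1)
    (fun k => p' k.1)
    (fun k => q' k.2) h1 h2 h1' h2' (by rw [h3, h3', ssa_trace_traceE]) (by
      intro t ht
      obtain ⟨Y, hY⟩ := ssaPhi_exists t ht U' V' p' q' hU' hV' hp' hq'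
      rw [← hY, ← e1', ← e2', ssa_ptL_traceE, ← ssa_traceE_kron, ← ssaPhi_hat]
      have := ssaPhi_le t ht U V (ssaHat Y) p q hU hV hp hq
      rw [← e1, ← e2] at this
      exact this)
  rw [h4, h5, h4', h5', ssa_ptL_traceE] at key
  rw [cmiSEgF]
  linarith
end

section
/- Let N be a squashing-channel candidate given by isometry conjugation V_{E→E'F'}, and let Ñ be another candidate whose isometry conjugation Ṽ_{E→E'F'} produces a symmetric quantum Markov chain from σ_{SE} (both I(S;F'|E') = 0 and I(S;E'|F') = 0 for the state Ṽ(σ_{SE})). Then I(S;E')_{Ṽ(σ_{SE})} + I(S;F')_{Ṽ(σ_{SE})} ≥ I(S;E')_{V(σ_{SE})} + I(S;F')_{V(σ_{SE})}. -/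
open Matrix BigOperators
open scoped Kronecker ComplexOrder

section aux

theorem quad_expand {n : Type*} [Fintype n] [DecidableEq n] (U W Y : Matrix n n ℂ)
    (hU : Uᴴ * U = 1) (hW : Wᴴ * W = 1) (p q : n → ℝ) (t : ℝ)
    (ρ σ X : Matrix n n ℂ)
    (hρ : ρ = U * diagonal (fun i => (p i : ℂ)) * Uᴴ)
    (hσ : σ = W * diagonal (fun i => (q i : ℂ)) * Wᴴ)
    (hX : X = W * Y * Uᴴ) :
    (2 * trace (ρ * Xᴴ) - trace (σ * (X * Xᴴ)) - t * trace (ρ * (Xᴴ * X))).re =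
    ∑ j, ∑ i, (2 * (star (Y j i) * (Wᴴ * U) j i).re * p i - (q j + t * p i) * Complex.normSq (Y j i)) := by
  have h1 : trace (ρ * Xᴴ) = ∑ j, ∑ i, star (Y j i) * (Wᴴ * U) j i * p i := by
    have : trace (ρ * Xᴴ) = trace ((Wᴴ * U) * diagonal (fun i => (p i : ℂ)) * Yᴴ) := by
      rw [hρ, hX]
      simp only [conjTranspose_mul, conjTranspose_conjTranspose]
      calc _ = trace ((U * diagonal (fun i => (p i : ℂ)) * (Uᴴ * U) * Yᴴ) * Wᴴ) := by
            simp only [Matrix.mul_assoc]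
        _ = _ := by rw [trace_mul_comm, hU]; simp only [Matrix.mul_assoc, Matrix.mul_one, Matrix.one_mul]
    rw [this, trace]
    refine Finset.sum_congr rfl fun j _ => ?_
    rw [diag_apply, Matrix.mul_apply]
    refine Finset.sum_congr rfl fun i _ => ?_
    rw [mul_diagonal, conjTranspose_apply]; ring
  have h2 : trace (σ * (X * Xᴴ)) = ∑ j, ∑ i, ((q j * Complex.normSq (Y j i) : ℝ) : ℂ) := by
    have : trace (σ * (X * Xᴴ)) = trace (diagonal (fun i => (q i : ℂ)) * (Y * Yᴴ)) := by
      rw [hσ, hX]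
      simp only [conjTranspose_mul, conjTranspose_conjTranspose]
      calc _ = trace ((W * diagonal (fun i => (q i : ℂ)) * (Wᴴ * W) * Y * (Uᴴ * U) * Yᴴ) * Wᴴ) := by
            simp only [Matrix.mul_assoc]
        _ = trace ((Wᴴ * W) * (diagonal (fun i => (q i : ℂ)) * (Y * Yᴴ))) := by
            rw [trace_mul_comm, hU, hW]; simp only [Matrix.mul_assoc, Matrix.mul_one, Matrix.one_mul]
            rw [← Matrix.mul_assoc, hW, Matrix.one_mul]
        _ = _ := by rw [hW, Matrix.one_mul]
    rw [this, trace]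
    refine Finset.sum_congr rfl fun j _ => ?_
    rw [diag_apply, diagonal_mul, Matrix.mul_apply, Finset.mul_sum]
    refine Finset.sum_congr rfl fun i _ => ?_
    rw [conjTranspose_apply, Complex.star_def, Complex.mul_conj]; push_cast; ring
  have h3 : trace (ρ * (Xᴴ * X)) = ∑ j, ∑ i, ((p i * Complex.normSq (Y j i) : ℝ) : ℂ) := by
    have : trace (ρ * (Xᴴ * X)) = trace (diagonal (fun i => (p i : ℂ)) * (Yᴴ * Y)) := by
      rw [hρ, hX]
      simp only [conjTranspose_mul, conjTranspose_conjTranspose]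
      calc _ = trace ((U * diagonal (fun i => (p i : ℂ)) * (Uᴴ * U) * Yᴴ * (Wᴴ * W) * Y) * Uᴴ) := by
            simp only [Matrix.mul_assoc]
        _ = trace ((Uᴴ * U) * (diagonal (fun i => (p i : ℂ)) * (Yᴴ * Y))) := by
            rw [trace_mul_comm, hU, hW]; simp only [Matrix.mul_assoc, Matrix.mul_one, Matrix.one_mul]
            rw [← Matrix.mul_assoc, hU, Matrix.one_mul]
        _ = _ := by rw [hU, Matrix.one_mul]
    rw [this, trace, Finset.sum_comm]
    refine Finset.sum_congr rfl fun j _ => ?_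
    rw [diag_apply, diagonal_mul, Matrix.mul_apply, Finset.mul_sum]
    refine Finset.sum_congr rfl fun i _ => ?_
    rw [conjTranspose_apply, Complex.star_def, mul_comm ((starRingEnd ℂ) _), Complex.mul_conj]; push_cast; ring
  rw [h1, h2, h3]
  simp only [Finset.mul_sum, ← Finset.sum_sub_distrib, Complex.re_sum]
  refine Finset.sum_congr rfl fun j _ => Finset.sum_congr rfl fun i _ => ?_
  simp only [Complex.sub_re, Complex.re_ofReal_mul, Complex.ofReal_re, Complex.re_mul_ofReal]
  have : ((2:ℂ) * (star (Y j i) * (Wᴴ * U) j i * (p i : ℂ))).re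
      = 2 * ((star (Y j i) * (Wᴴ * U) j i).re * p i) := by
    rw [show (2:ℂ) = ((2:ℝ):ℂ) by norm_num, Complex.re_ofReal_mul, Complex.re_mul_ofReal]
  rw [this]; ring

theorem quad_le {n : Type*} [Fintype n] [DecidableEq n] (U W X : Matrix n n ℂ)
    (hU : Uᴴ * U = 1) (hW : Wᴴ * W = 1) (p q : n → ℝ) (hp : ∀ i, 0 < p i) (hq : ∀ i, 0 < q i)
    (t : ℝ) (ht : 0 ≤ t) (ρ σ : Matrix n n ℂ)
    (hρ : ρ = U * diagonal (fun i => (p i : ℂ)) * Uᴴ)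
    (hσ : σ = W * diagonal (fun i => (q i : ℂ)) * Wᴴ) :
    (2 * trace (ρ * Xᴴ) - trace (σ * (X * Xᴴ)) - t * trace (ρ * (Xᴴ * X))).re ≤
    ∑ j, ∑ i, Complex.normSq ((Wᴴ * U) j i) * (p i * (p i / (q j + t * p i))) := by
  have hU' : U * Uᴴ = 1 := mul_eq_one_comm.mp hU
  have hW' : W * Wᴴ = 1 := mul_eq_one_comm.mp hW
  rw [quad_expand U W (Wᴴ * X * U) hU hW p q t ρ σ X hρ hσ (by
    calc X = (W * Wᴴ) * X * (U * Uᴴ) := by rw [hU', hW']; simp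
      _ = _ := by simp only [Matrix.mul_assoc])]
  refine Finset.sum_le_sum fun j _ => Finset.sum_le_sum fun i _ => ?_
  generalize (Wᴴ * X * U) j i = y
  generalize (Wᴴ * U) j i = w
  have hc : 0 < q j + t * p i := by have := hp i; have := hq j; positivity
  generalize q j + t * p i = c at *
  generalize p i = a at *
  rw [show Complex.normSq w * (a * (a / c)) = (Complex.normSq w * a ^ 2) / c by ring, le_div_iff₀ hc]
  simp only [Complex.normSq_apply, Complex.star_def, Complex.mul_re, Complex.conj_re, Complex.conj_im]
  nlinarith [sq_nonneg (c * y.re - a * w.re), sq_nonneg (c * y.im - a * w.im)]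

theorem quad_attained {n : Type*} [Fintype n] [DecidableEq n] (U W : Matrix n n ℂ)
    (hU : Uᴴ * U = 1) (hW : Wᴴ * W = 1) (p q : n → ℝ) (hp : ∀ i, 0 < p i) (hq : ∀ i, 0 < q i)
    (t : ℝ) (ht : 0 ≤ t) (ρ σ : Matrix n n ℂ)
    (hρ : ρ = U * diagonal (fun i => (p i : ℂ)) * Uᴴ)
    (hσ : σ = W * diagonal (fun i => (q i : ℂ)) * Wᴴ) :
    ∃ X : Matrix n n ℂ,
    (2 * trace (ρ * Xᴴ) - trace (σ * (X * Xᴴ)) - t * trace (ρ * (Xᴴ * X))).re =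
    ∑ j, ∑ i, Complex.normSq ((Wᴴ * U) j i) * (p i * (p i / (q j + t * p i))) := by
  refine ⟨W * (Matrix.of fun j i => (((p i / (q j + t * p i) : ℝ)) : ℂ) * (Wᴴ * U) j i) * Uᴴ, ?_⟩
  rw [quad_expand U W _ hU hW p q t ρ σ _ hρ hσ rfl]
  refine Finset.sum_congr rfl fun j _ => Finset.sum_congr rfl fun i _ => ?_
  simp only [Matrix.of_apply]
  generalize (Wᴴ * U) j i = w
  have hc : 0 < q j + t * p i := by have := hp i; have := hq j; positivity
  generalize q j + t * p i = c at *
  generalize p i = a at *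
  simp only [Complex.normSq_apply, Complex.star_def, Complex.mul_re, Complex.conj_re, Complex.conj_im,
    Complex.mul_im, Complex.ofReal_re, Complex.ofReal_im]
  field_simp
  ring

/-- Monotonicity of relative entropy, in spectral form. -/
theorem relent_mono {n m : Type*} [Fintype n] [DecidableEq n] [Fintype m] [DecidableEq m]
    (U W : Matrix n n ℂ) (U' W' : Matrix m m ℂ)
    (hU : Uᴴ * U = 1) (hW : Wᴴ * W = 1) (hU' : U'ᴴ * U' = 1) (hW' : W'ᴴ * W' = 1)
    (p q : n → ℝ) (hp : ∀ i, 0 < p i) (hq : ∀ i, 0 < q i)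
    (p' q' : m → ℝ) (hp' : ∀ i, 0 < p' i) (hq' : ∀ i, 0 < q' i)
    (ρ σ : Matrix n n ℂ) (ρ' σ' : Matrix m m ℂ)
    (hρ : ρ = U * diagonal (fun i => (p i : ℂ)) * Uᴴ)
    (hσ : σ = W * diagonal (fun i => (q i : ℂ)) * Wᴴ)
    (hρ' : ρ' = U' * diagonal (fun i => (p' i : ℂ)) * U'ᴴ)
    (hσ' : σ' = W' * diagonal (fun i => (q' i : ℂ)) * W'ᴴ)
    (J : Matrix m m ℂ → Matrix n n ℂ) (Jmul : ∀ X Y, J (X * Y) = J X * J Y)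
    (Jstar : ∀ X, J (Xᴴ) = (J X)ᴴ)
    (Jρ : ∀ X, trace (ρ * J X) = trace (ρ' * X))
    (Jσ : ∀ X, trace (σ * J X) = trace (σ' * X))
    (hsum : ∑ j, ∑ i, Complex.normSq ((Wᴴ * U) j i) * p i
      = ∑ j, ∑ i, Complex.normSq ((W'ᴴ * U') j i) * p' i) :
    ∑ j, ∑ i, Complex.normSq ((W'ᴴ * U') j i) * (p' i * (Real.log (p' i) - Real.log (q' j))) ≤
    ∑ j, ∑ i, Complex.normSq ((Wᴴ * U) j i) * (p i * (Real.log (p i) - Real.log (q j))) := by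
  have hF : ∀ t : ℝ, 0 ≤ t →
      ∑ j, ∑ i, Complex.normSq ((W'ᴴ * U') j i) * (p' i * (p' i / (q' j + t * p' i))) ≤
      ∑ j, ∑ i, Complex.normSq ((Wᴴ * U) j i) * (p i * (p i / (q j + t * p i))) := by
    intro t ht
    obtain ⟨X, hX⟩ := quad_attained U' W' hU' hW' p' q' hp' hq' t ht ρ' σ' hρ' hσ'
    rw [← hX, ← Jρ, ← Jρ, ← Jσ, Jmul, Jmul, Jstar]
    exact quad_le U W (J X) hU hW p q hp hq t ht ρ σ hρ hσ
  have hd : ∀ {k : Type _} [Fintype k] (w : k → k → ℝ) (p q : k → ℝ) (hp : ∀ i, 0 < p i)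
      (hq : ∀ i, 0 < q i) (t : ℝ), 0 ≤ t →
      HasDerivAt (fun t => ∑ j, ∑ i, w j i * (p i * (Real.log (q j + t * p i) - Real.log (q j))))
        (∑ j, ∑ i, w j i * (p i * (p i / (q j + t * p i)))) t := by
    intro k _ w p q hp hq t ht
    refine HasDerivAt.fun_sum fun j _ => HasDerivAt.fun_sum fun i _ => ?_
    have hc : 0 < q j + t * p i := by have := hp i; have := hq j; positivity
    refine HasDerivAt.const_mul _ (HasDerivAt.const_mul _ (HasDerivAt.sub_const _ ?_))
    refine HasDerivAt.log ?_ hc.ne'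
    simpa using ((hasDerivAt_id t).mul_const (p i)).const_add (q j)
  have hd' : ∀ {k : Type _} [Fintype k] (w : k → k → ℝ) (p q : k → ℝ) (hp : ∀ i, 0 < p i)
      (hq : ∀ i, 0 < q i) (t : ℝ), 0 ≤ t →
      HasDerivAt (fun t => ∑ j, ∑ i, w j i * (p i * (Real.log (q j + t * p i) - Real.log (q j))))
        (∑ j, ∑ i, w j i * (p i * (p i / (q j + t * p i)))) t := by
    intro k _ w p q hp hq t ht
    refine HasDerivAt.fun_sum fun j _ => HasDerivAt.fun_sum fun i _ => ?_
    have hc : 0 < q j + t * p i := by have := hp i; have := hq j; positivity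
    refine HasDerivAt.const_mul _ (HasDerivAt.const_mul _ (HasDerivAt.sub_const _ ?_))
    refine HasDerivAt.log ?_ hc.ne'
    simpa using ((hasDerivAt_id t).mul_const (p i)).const_add (q j)
  have hD : ∀ t : ℝ, 0 ≤ t → HasDerivAt (fun t =>
      (∑ j, ∑ i, Complex.normSq ((Wᴴ * U) j i) * (p i * (Real.log (q j + t * p i) - Real.log (q j))))
      - ∑ j, ∑ i, Complex.normSq ((W'ᴴ * U') j i) * (p' i * (Real.log (q' j + t * p' i) - Real.log (q' j))))
      ((∑ j, ∑ i, Complex.normSq ((Wᴴ * U) j i) * (p i * (p i / (q j + t * p i))))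
      - ∑ j, ∑ i, Complex.normSq ((W'ᴴ * U') j i) * (p' i * (p' i / (q' j + t * p' i)))) t :=
    fun t ht => (hd (fun j i => Complex.normSq ((Wᴴ * U) j i)) p q hp hq t ht).sub
      (hd' (fun j i => Complex.normSq ((W'ᴴ * U') j i)) p' q' hp' hq' t ht)
  have hmono := monotoneOn_of_deriv_nonneg (convex_Ici (0:ℝ))
    (fun t ht => (hD t ht).continuousAt.continuousWithinAt)
    (fun t ht => (hD t (interior_subset ht)).differentiableAt.differentiableWithinAt)
    (fun t ht => by
      rw [(hD t (interior_subset ht)).deriv]; exact sub_nonneg.2 (hF t (interior_subset ht)))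
  have hG : ∀ T : ℝ, 0 < T →
      ∑ j, ∑ i, Complex.normSq ((W'ᴴ * U') j i) * (p' i * (Real.log (q' j * T⁻¹ + p' i) - Real.log (q' j))) ≤
      ∑ j, ∑ i, Complex.normSq ((Wᴴ * U) j i) * (p i * (Real.log (q j * T⁻¹ + p i) - Real.log (q j))) := by
    intro T hT
    have h0 := hmono (Set.mem_Ici.2 le_rfl) (Set.mem_Ici.2 hT.le) hT.le
    simp only [zero_mul, add_zero, sub_self, mul_zero, Finset.sum_const_zero] at h0
    have e1 : ∀ j i, Complex.normSq ((Wᴴ * U) j i) * (p i * (Real.log (q j + T * p i) - Real.log (q j)))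
        = Complex.normSq ((Wᴴ * U) j i) * (p i * (Real.log (q j * T⁻¹ + p i) - Real.log (q j)))
          + Real.log T * (Complex.normSq ((Wᴴ * U) j i) * p i) := by
      intro j i
      have hc : 0 < q j * T⁻¹ + p i := by have := hp i; have := hq j; positivity
      rw [show q j + T * p i = T * (q j * T⁻¹ + p i) by field_simp, Real.log_mul hT.ne' hc.ne']
      ring
    have e2 : ∀ j i, Complex.normSq ((W'ᴴ * U') j i) * (p' i * (Real.log (q' j + T * p' i) - Real.log (q' j)))
        = Complex.normSq ((W'ᴴ * U') j i) * (p' i * (Real.log (q' j * T⁻¹ + p' i) - Real.log (q' j)))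
          + Real.log T * (Complex.normSq ((W'ᴴ * U') j i) * p' i) := by
      intro j i
      have hc : 0 < q' j * T⁻¹ + p' i := by have := hp' i; have := hq' j; positivity
      rw [show q' j + T * p' i = T * (q' j * T⁻¹ + p' i) by field_simp, Real.log_mul hT.ne' hc.ne']
      ring
    simp only [e1, e2, Finset.sum_add_distrib, ← Finset.mul_sum, hsum] at h0
    linarith
  have hlim : ∀ {k : Type _} [Fintype k] (w : k → k → ℝ) (p q : k → ℝ) (hp : ∀ i, 0 < p i),
      Filter.Tendsto (fun T : ℝ => ∑ j, ∑ i, w j i * (p i * (Real.log (q j * T⁻¹ + p i) - Real.log (q j))))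
        Filter.atTop (nhds (∑ j, ∑ i, w j i * (p i * (Real.log (p i) - Real.log (q j))))) := by
    intro k _ w p q hp
    refine tendsto_finsetSum _ fun j _ => tendsto_finsetSum _ fun i _ => ?_
    refine ((Filter.Tendsto.sub_const ?_ _).const_mul _).const_mul _
    refine Filter.Tendsto.log ?_ (hp i).ne'
    simpa using (tendsto_inv_atTop_zero.const_mul (q j)).add_const (p i)
  have hlim' : ∀ {k : Type _} [Fintype k] (w : k → k → ℝ) (p q : k → ℝ) (hp : ∀ i, 0 < p i),
      Filter.Tendsto (fun T : ℝ => ∑ j, ∑ i, w j i * (p i * (Real.log (q j * T⁻¹ + p i) - Real.log (q j))))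
        Filter.atTop (nhds (∑ j, ∑ i, w j i * (p i * (Real.log (p i) - Real.log (q j))))) := by
    intro k _ w p q hp
    refine tendsto_finsetSum _ fun j _ => tendsto_finsetSum _ fun i _ => ?_
    refine ((Filter.Tendsto.sub_const ?_ _).const_mul _).const_mul _
    refine Filter.Tendsto.log ?_ (hp i).ne'
    simpa using (tendsto_inv_atTop_zero.const_mul (q j)).add_const (p i)
  exact le_of_tendsto_of_tendsto
    (hlim' (fun j i => Complex.normSq ((W'ᴴ * U') j i)) p' q' hp')
    (hlim (fun j i => Complex.normSq ((Wᴴ * U) j i)) p q hp)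
    (Filter.eventually_atTop.2 ⟨1, fun T hT => hG T (by linarith)⟩)

theorem vN_eq_roots {n : Type*} [Fintype n] [DecidableEq n] (ρ : Matrix n n ℂ) (h : ρ.IsHermitian) :
    vN ρ = (ρ.charpoly.roots.map (fun z => Real.negMulLog z.re)).sum := by
  rw [vN, dif_pos h, h.roots_charpoly_eq_eigenvalues, Multiset.map_map, ← Finset.sum_neg_distrib]
  refine Finset.sum_congr rfl fun i _ => ?_
  simp [Real.negMulLog]

theorem vN_diag {n : Type*} [Fintype n] [DecidableEq n] (ρ U : Matrix n n ℂ) (p : n → ℝ)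
    (hU : Uᴴ * U = 1) (hρ : ρ = U * diagonal (fun i => (p i : ℂ)) * Uᴴ) :
    vN ρ = ∑ i, Real.negMulLog (p i) := by
  have h : ρ.IsHermitian := by
    rw [hρ]
    refine isHermitian_mul_mul_conjTranspose _ ?_
    refine isHermitian_diagonal_of_self_adjoint _ ?_
    ext i; simp
  rw [vN_eq_roots ρ h]
  have : ρ.charpoly = ∏ i, (Polynomial.X - Polynomial.C (p i : ℂ)) := by
    rw [hρ, charpoly_mul_comm, ← Matrix.mul_assoc, hU, Matrix.one_mul, charpoly_diagonal]
  have hr : (∏ i, (Polynomial.X - Polynomial.C (p i : ℂ))).roots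
      = Finset.univ.val.map (fun i => (p i : ℂ)) := by
    rw [Polynomial.roots_prod]
    · simp
    · exact Finset.prod_ne_zero_iff.2 fun i _ => Polynomial.X_sub_C_ne_zero _
  rw [this, hr, Multiset.map_map]
  rfl

theorem vN_isom {n m : Type*} [Fintype n] [DecidableEq n] [Fintype m] [DecidableEq m]
    (V : Matrix m n ℂ) (hV : Vᴴ * V = 1) (σ : Matrix n n ℂ) (h : σ.IsHermitian) :
    vN (V * σ * Vᴴ) = vN σ := by
  rw [vN_eq_roots _ h, vN_eq_roots _ (isHermitian_mul_mul_conjTranspose _ h)]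
  have h1 := charpoly_mul_comm' V (σ * Vᴴ)
  rw [Matrix.mul_assoc σ, hV, Matrix.mul_one, ← Matrix.mul_assoc] at h1
  have h2 := congrArg (fun P : Polynomial ℂ => (P.roots.map (fun z => Real.negMulLog z.re)).sum) h1
  have hX : ∀ k : ℕ, (Polynomial.X ^ k : Polynomial ℂ) ≠ 0 := fun k => pow_ne_zero _ Polynomial.X_ne_zero
  rw [Polynomial.roots_mul (mul_ne_zero (hX _) (charpoly_monic _).ne_zero),
    Polynomial.roots_mul (mul_ne_zero (hX _) (charpoly_monic _).ne_zero)] at h2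
  simpa [Multiset.map_nsmul, Multiset.sum_nsmul] using h2

theorem spec_exists {n : Type*} [Fintype n] [DecidableEq n] (ρ : Matrix n n ℂ) (h : ρ.IsHermitian) :
    ∃ (U : Matrix n n ℂ), Uᴴ * U = 1 ∧
      ρ = U * diagonal (fun i => (h.eigenvalues i : ℂ)) * Uᴴ := by
  refine ⟨h.eigenvectorUnitary, ?_, ?_⟩
  · rw [← star_eq_conjTranspose]; exact Unitary.coe_star_mul_self _
  · have := h.spectral_theorem
    rw [Unitary.conjStarAlgAut_apply] at this
    exact this

theorem vN_shift {n : Type*} [Fintype n] [DecidableEq n] (ρ : Matrix n n ℂ) (h : ρ.IsHermitian) (c : ℝ) :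
    Filter.Tendsto (fun ε : ℝ => vN (ρ + ((ε * c : ℝ) : ℂ) • (1 : Matrix n n ℂ)))
      (nhdsWithin 0 (Set.Ioi 0)) (nhds (vN ρ)) := by
  obtain ⟨U, hU, hρ⟩ := spec_exists ρ h
  have hU' : U * Uᴴ = 1 := mul_eq_one_comm.mp hU
  have e : ∀ ε : ℝ, vN (ρ + ((ε * c : ℝ) : ℂ) • (1 : Matrix n n ℂ))
      = ∑ i, Real.negMulLog (h.eigenvalues i + ε * c) := by
    intro ε
    refine vN_diag _ U _ hU ?_
    have : diagonal (fun i => ((h.eigenvalues i + ε * c : ℝ) : ℂ))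
        = diagonal (fun i => (h.eigenvalues i : ℂ)) + ((ε * c : ℝ) : ℂ) • (1 : Matrix n n ℂ) := by
      rw [smul_one_eq_diagonal, diagonal_add]; simp
    rw [this, Matrix.mul_add, Matrix.add_mul, ← hρ]
    simp [hU']
  simp only [e]
  rw [vN_diag ρ U _ hU hρ]
  refine Filter.Tendsto.mono_left ?_ nhdsWithin_le_nhds
  have : Continuous (fun ε : ℝ => ∑ i, Real.negMulLog (h.eigenvalues i + ε * c)) := by
    refine continuous_finsetSum _ fun i _ => Real.continuous_negMulLog.comp (by fun_prop)
  simpa using this.tendsto 0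

theorem ptL_conj {S A B : Type*} [Fintype S] [DecidableEq S] [Fintype A] [Fintype B]
    (M : Matrix A B ℂ) (N : Matrix B A ℂ) (ρ : Matrix (S × B) (S × B) ℂ) :
    ptL (((1 : Matrix S S ℂ) ⊗ₖ M) * ρ * ((1 : Matrix S S ℂ) ⊗ₖ N)) = M * ptL ρ * N := by
  ext a b
  simp only [ptL, of_apply, Matrix.mul_apply, Fintype.sum_prod_type, kroneckerMap_apply, one_apply,
    ite_mul, mul_ite, one_mul, zero_mul, mul_zero, Finset.sum_ite_irrel, Finset.sum_const_zero,
    Finset.sum_ite_eq, Finset.sum_ite_eq', Finset.mem_univ, if_true]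
  rw [Finset.sum_comm]
  refine Finset.sum_congr rfl fun x _ => ?_
  simp only [Finset.sum_mul, Finset.mul_sum]
  rw [Finset.sum_comm]

theorem ptR_conj {S A B : Type*} [Fintype S] [DecidableEq S] [Fintype A] [Fintype B] [DecidableEq B]
    (M : Matrix A B ℂ) (hM : Mᴴ * M = 1) (ρ : Matrix (S × B) (S × B) ℂ) :
    ptR (((1 : Matrix S S ℂ) ⊗ₖ M) * ρ * ((1 : Matrix S S ℂ) ⊗ₖ M)ᴴ) = ptR ρ := by
  ext s s'
  have h : ∀ x y, ∑ a, star (M a x) * M a y = if x = y then 1 else 0 := by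
    intro x y
    have := congrFun (congrFun hM x) y
    simpa [Matrix.mul_apply, one_apply] using this
  rw [conjTranspose_kronecker, conjTranspose_one]
  simp only [ptR, of_apply, Matrix.mul_apply, Fintype.sum_prod_type, kroneckerMap_apply, one_apply,
    ite_mul, mul_ite, one_mul, zero_mul, mul_zero, Finset.sum_ite_irrel, Finset.sum_const_zero,
    Finset.sum_ite_eq, Finset.sum_ite_eq', Finset.mem_univ, if_true, conjTranspose_apply]
  simp only [Finset.sum_mul]
  rw [Finset.sum_comm]
  calc _ = ∑ y, ∑ x, (∑ a, star (M a y) * M a x) * ρ (s, x) (s', y) := by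
        refine Finset.sum_congr rfl fun y _ => ?_
        rw [Finset.sum_comm]
        refine Finset.sum_congr rfl fun x _ => ?_
        rw [Finset.sum_mul]
        refine Finset.sum_congr rfl fun a _ => ?_
        ring
    _ = _ := by simp only [h]; simp

theorem normSq_row {n : Type*} [Fintype n] [DecidableEq n] (Z : Matrix n n ℂ) (p : n → ℝ) (j : n) :
    ((∑ i, Complex.normSq (Z j i) * p i : ℝ) : ℂ)
      = (Z * diagonal (fun i => (p i : ℂ)) * Zᴴ) j j := by
  rw [Matrix.mul_apply]
  push_cast
  refine Finset.sum_congr rfl fun i _ => ?_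
  rw [mul_diagonal, conjTranspose_apply, Complex.star_def, ← Complex.mul_conj]; ring

theorem normSq_col {n : Type*} [Fintype n] [DecidableEq n] (U W : Matrix n n ℂ)
    (hU : Uᴴ * U = 1) (hW : Wᴴ * W = 1) (i : n) :
    ∑ j, Complex.normSq ((Wᴴ * U) j i) = 1 := by
  have hW' : W * Wᴴ = 1 := mul_eq_one_comm.mp hW
  have h : (Wᴴ * U)ᴴ * (Wᴴ * U) = 1 := by
    rw [conjTranspose_mul, conjTranspose_conjTranspose]
    calc _ = Uᴴ * (W * Wᴴ) * U := by simp only [Matrix.mul_assoc]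
      _ = _ := by rw [hW', Matrix.mul_one, hU]
  have h2 := congrFun (congrFun h i) i
  rw [Matrix.mul_apply, one_apply_eq] at h2
  have : ((∑ j, Complex.normSq ((Wᴴ * U) j i) : ℝ) : ℂ) = 1 := by
    rw [← h2]; push_cast
    refine Finset.sum_congr rfl fun j _ => ?_
    rw [conjTranspose_apply, Complex.star_def, ← Complex.mul_conj]; ring
  exact_mod_cast this

theorem kron_isom {S A B : Type*} [DecidableEq S] [Fintype S] [Fintype A] [Fintype B] [DecidableEq B]
    (M : Matrix A B ℂ) (hM : Mᴴ * M = 1) :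
    ((1 : Matrix S S ℂ) ⊗ₖ M)ᴴ * ((1 : Matrix S S ℂ) ⊗ₖ M) = 1 := by
  rw [conjTranspose_kronecker, ← mul_kronecker_mul, hM]; simp

theorem relent_eval {S B : Type*} [Fintype S] [DecidableEq S] [Fintype B] [DecidableEq B]
    (ρ U : Matrix (S × B) (S × B) ℂ) (M : Matrix B B ℂ) (p : S × B → ℝ) (q : B → ℝ)
    (hU : Uᴴ * U = 1) (hM : Mᴴ * M = 1)
    (hρ : ρ = U * diagonal (fun i => (p i : ℂ)) * Uᴴ)
    (hL : ptL ρ = M * diagonal (fun i => (q i : ℂ)) * Mᴴ) :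
    ∑ j, ∑ i, Complex.normSq ((((1 : Matrix S S ℂ) ⊗ₖ M)ᴴ * U) j i) *
      (p i * (Real.log (p i) - Real.log (q j.2))) = - vN ρ + vN (ptL ρ) := by
  have hW := kron_isom (S := S) M hM
  rw [vN_diag ρ U p hU hρ, vN_diag _ M q hM hL]
  simp only [mul_sub, Finset.sum_sub_distrib]
  have h1 : ∑ j, ∑ i, Complex.normSq ((((1 : Matrix S S ℂ) ⊗ₖ M)ᴴ * U) j i) *
      (p i * Real.log (p i)) = - ∑ i, Real.negMulLog (p i) := by
    rw [Finset.sum_comm, ← Finset.sum_neg_distrib]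
    refine Finset.sum_congr rfl fun i _ => ?_
    rw [← Finset.sum_mul, normSq_col _ _ hU hW, Real.negMulLog]; ring
  have h2 : ∑ j, ∑ i, Complex.normSq ((((1 : Matrix S S ℂ) ⊗ₖ M)ᴴ * U) j i) *
      (p i * Real.log (q j.2)) = - ∑ i, Real.negMulLog (q i) := by
    have e : ∀ b, ∑ s : S, ∑ i, Complex.normSq ((((1 : Matrix S S ℂ) ⊗ₖ M)ᴴ * U) (s, b) i) * p i = q b := by
      intro b
      have : ((∑ s : S, ∑ i, Complex.normSq ((((1 : Matrix S S ℂ) ⊗ₖ M)ᴴ * U) (s, b) i) * p i : ℝ) : ℂ)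
          = q b := by
        rw [Complex.ofReal_sum]
        simp only [normSq_row]
        have hh : (((1 : Matrix S S ℂ) ⊗ₖ M)ᴴ * U) * diagonal (fun i => (p i : ℂ)) *
            (((1 : Matrix S S ℂ) ⊗ₖ M)ᴴ * U)ᴴ
            = ((1 : Matrix S S ℂ) ⊗ₖ Mᴴ) * ρ * ((1 : Matrix S S ℂ) ⊗ₖ M) := by
          rw [hρ, conjTranspose_mul, conjTranspose_conjTranspose, conjTranspose_kronecker, conjTranspose_one]
          simp only [Matrix.mul_assoc]
        rw [hh]
        have h3 := congrFun (congrFun (ptL_conj (S := S) Mᴴ M ρ) b) b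
        rw [hL] at h3
        have h4 : Mᴴ * (M * diagonal (fun i => (q i : ℂ)) * Mᴴ) * M = diagonal (fun i => (q i : ℂ)) := by
          calc _ = (Mᴴ * M) * diagonal (fun i => (q i : ℂ)) * (Mᴴ * M) := by simp only [Matrix.mul_assoc]
            _ = _ := by rw [hM]; simp
        rw [h4, diagonal_apply_eq] at h3
        rw [← h3]; rfl
      exact_mod_cast this
    rw [Fintype.sum_prod_type, Finset.sum_comm, ← Finset.sum_neg_distrib]
    refine Finset.sum_congr rfl fun b _ => ?_
    simp only [← mul_assoc, ← Finset.sum_mul]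
    rw [e, Real.negMulLog]; ring
  rw [h1, h2]; ring

theorem traceF_J {S E F : Type*} [Fintype S] [Fintype E] [Fintype F] [DecidableEq F]
    (ρ : Matrix (S × E × F) (S × E × F) ℂ) (X : Matrix (S × E) (S × E) ℂ) :
    trace (ρ * ((X ⊗ₖ (1 : Matrix F F ℂ)).submatrix (Equiv.prodAssoc S E F).symm (Equiv.prodAssoc S E F).symm))
      = trace (traceF ρ * X) := by
  simp only [trace, diag_apply, Matrix.mul_apply, submatrix_apply, kroneckerMap_apply, traceF, of_apply,
    Fintype.sum_prod_type, Equiv.prodAssoc_symm_apply, one_apply, mul_ite, mul_one, mul_zero,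
    Finset.sum_ite_eq, Finset.sum_ite_eq', Finset.mem_univ, if_true, Finset.sum_mul]
  refine Finset.sum_congr rfl fun s _ => Finset.sum_congr rfl fun e _ => ?_
  rw [Finset.sum_comm]
  refine Finset.sum_congr rfl fun s' _ => ?_
  rw [Finset.sum_comm]

theorem traceF_kron {S E F : Type*} [DecidableEq S] [Fintype F] (τ : Matrix (E × F) (E × F) ℂ) :
    traceF ((1 : Matrix S S ℂ) ⊗ₖ τ) = (1 : Matrix S S ℂ) ⊗ₖ ptR τ := by
  ext ⟨s, e⟩ ⟨s', e'⟩
  simp [traceF, ptR, Finset.mul_sum]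

theorem ptR_ptL {S E F : Type*} [Fintype S] [Fintype F] (ρ : Matrix (S × E × F) (S × E × F) ℂ) :
    ptR (ptL ρ) = ptL (traceF ρ) := by
  ext e e'
  simp only [traceF, ptR, ptL, of_apply]
  rw [Finset.sum_comm]

theorem kron_spec {S B : Type*} [Fintype S] [DecidableEq S] [Fintype B] [DecidableEq B]
    (τ M : Matrix B B ℂ) (q : B → ℝ) (h : τ = M * diagonal (fun i => (q i : ℂ)) * Mᴴ) :
    (1 : Matrix S S ℂ) ⊗ₖ τ = ((1 : Matrix S S ℂ) ⊗ₖ M) *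
      diagonal (fun j : S × B => (q j.2 : ℂ)) * ((1 : Matrix S S ℂ) ⊗ₖ M)ᴴ := by
  have : diagonal (fun j : S × B => (q j.2 : ℂ)) = (1 : Matrix S S ℂ) ⊗ₖ diagonal (fun i => (q i : ℂ)) := by
    rw [← diagonal_one, diagonal_kronecker_diagonal]; simp
  rw [this, conjTranspose_kronecker, conjTranspose_one, ← mul_kronecker_mul, ← mul_kronecker_mul, h]; simp

theorem sum_weights {n : Type*} [Fintype n] [DecidableEq n] (ρ U W : Matrix n n ℂ) (p : n → ℝ)
    (hU : Uᴴ * U = 1) (hW : Wᴴ * W = 1) (hρ : ρ = U * diagonal (fun i => (p i : ℂ)) * Uᴴ) :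
    ∑ j, ∑ i, Complex.normSq ((Wᴴ * U) j i) * p i = (trace ρ).re := by
  rw [Finset.sum_comm, hρ, Matrix.trace_mul_comm, ← Matrix.mul_assoc, hU, Matrix.one_mul, trace_diagonal,
    Complex.re_sum]
  refine Finset.sum_congr rfl fun i _ => ?_
  rw [← Finset.sum_mul, normSq_col _ _ hU hW]; simp

theorem ssa_posDef {S E F : Type*} [Fintype S] [Fintype E] [Fintype F]
    [DecidableEq S] [DecidableEq E] [DecidableEq F]
    (ρ : Matrix (S × E × F) (S × E × F) ℂ) (h1 : ρ.PosDef) (h2 : (traceF ρ).PosDef)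
    (h3 : (ptL ρ).PosDef) (h4 : (ptL (traceF ρ)).PosDef) :
    0 ≤ cmiSFgE ρ := by
  obtain ⟨U, hU, hρ⟩ := spec_exists _ h1.isHermitian
  obtain ⟨U', hU', hρ'⟩ := spec_exists _ h2.isHermitian
  obtain ⟨M, hM, hσ⟩ := spec_exists _ h3.isHermitian
  obtain ⟨M', hM', hσ'⟩ := spec_exists _ h4.isHermitian
  have hW := kron_isom (S := S) M hM
  have hW' := kron_isom (S := S) M' hM'
  have key := relent_mono U ((1 : Matrix S S ℂ) ⊗ₖ M) U' ((1 : Matrix S S ℂ) ⊗ₖ M')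
    hU hW hU' hW'
    h1.isHermitian.eigenvalues (fun j => h3.isHermitian.eigenvalues j.2) h1.eigenvalues_pos
    (fun j => h3.eigenvalues_pos j.2)
    h2.isHermitian.eigenvalues (fun j => h4.isHermitian.eigenvalues j.2) h2.eigenvalues_pos
    (fun j => h4.eigenvalues_pos j.2)
    ρ ((1 : Matrix S S ℂ) ⊗ₖ ptL ρ) (traceF ρ) ((1 : Matrix S S ℂ) ⊗ₖ ptL (traceF ρ))
    hρ (kron_spec _ _ _ hσ) hρ' (kron_spec _ _ _ hσ')
    (fun X => (X ⊗ₖ (1 : Matrix F F ℂ)).submatrix (Equiv.prodAssoc S E F).symm (Equiv.prodAssoc S E F).symm)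
    (fun X Y => by
      rw [submatrix_mul_equiv, ← mul_kronecker_mul, Matrix.one_mul])
    (fun X => by
      rw [conjTranspose_submatrix, conjTranspose_kronecker, conjTranspose_one])
    (traceF_J ρ)
    (fun X => by rw [traceF_J, traceF_kron, ptR_ptL])
    (by
      rw [sum_weights ρ U _ _ hU hW hρ, sum_weights _ U' _ _ hU' hW' hρ']
      have := traceF_J ρ 1
      rw [one_kronecker_one, submatrix_one_equiv, Matrix.mul_one, Matrix.mul_one] at this
      rw [this])
  rw [relent_eval ρ U M _ _ hU hM hρ hσ, relent_eval _ U' M' _ _ hU' hM' hρ' hσ'] at key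
  rw [cmiSFgE]
  linarith

theorem ptL_psd {A B : Type*} [Fintype A] [Finite B] {ρ : Matrix (A × B) (A × B) ℂ}
    (h : ρ.PosSemidef) : (ptL ρ).PosSemidef := by
  have : ptL ρ = ∑ a, ρ.submatrix (fun b => (a, b)) (fun b => (a, b)) := by
    ext x y; simp [ptL, Matrix.sum_apply]
  rw [this]
  exact posSemidef_sum _ fun a _ => h.submatrix _

theorem traceF_psd {S E F : Type*} [Finite S] [Finite E] [Fintype F]
    {ρ : Matrix (S × E × F) (S × E × F) ℂ}
    (h : ρ.PosSemidef) : (traceF ρ).PosSemidef := by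
  have : traceF ρ = ∑ f, ρ.submatrix (fun b => (b.1, b.2, f)) (fun b => (b.1, b.2, f)) := by
    ext x y; simp [traceF, Matrix.sum_apply]
  rw [this]
  exact posSemidef_sum _ fun a _ => h.submatrix _

theorem ptL_shift {A B : Type*} [Fintype A] [DecidableEq A] [DecidableEq B]
    (ρ : Matrix (A × B) (A × B) ℂ) (c : ℝ) :
    ptL (ρ + (c : ℂ) • 1) = ptL ρ + ((c * Fintype.card A : ℝ) : ℂ) • 1 := by
  ext x y
  by_cases h : x = y <;> simp [ptL, one_apply, Finset.sum_add_distrib, h, mul_comm]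

theorem traceF_shift {S E F : Type*} [DecidableEq S] [DecidableEq E] [DecidableEq F] [Fintype F]
    (ρ : Matrix (S × E × F) (S × E × F) ℂ) (c : ℝ) :
    traceF (ρ + (c : ℂ) • 1) = traceF ρ + ((c * Fintype.card F : ℝ) : ℂ) • 1 := by
  ext ⟨s, e⟩ ⟨s', e'⟩
  by_cases h : s = s' <;> by_cases h' : e = e' <;>
    simp [traceF, one_apply, Finset.sum_add_distrib, h, h', mul_comm]

theorem shift_posDef {n : Type*} [Fintype n] [DecidableEq n] {ρ : Matrix n n ℂ}
    (h : ρ.PosSemidef) {c : ℝ} (hc : 0 < c) : (ρ + (c : ℂ) • (1 : Matrix n n ℂ)).PosDef := by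
  refine PosDef.posSemidef_add h (PosDef.one.smul ?_)
  exact_mod_cast hc

theorem ssa {S E F : Type*} [Fintype S] [Fintype E] [Fintype F]
    [DecidableEq S] [DecidableEq E] [DecidableEq F] [Nonempty S] [Nonempty F]
    (ρ : Matrix (S × E × F) (S × E × F) ℂ) (h : ρ.PosSemidef) :
    0 ≤ cmiSFgE ρ := by
  have hS : (0:ℝ) < Fintype.card S := by exact_mod_cast Fintype.card_pos
  have hF : (0:ℝ) < Fintype.card F := by exact_mod_cast Fintype.card_pos
  have hlim := (((vN_shift _ (traceF_psd h).isHermitian (Fintype.card F)).add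
    (vN_shift _ (ptL_psd h).isHermitian (Fintype.card S))).sub
    (vN_shift _ h.isHermitian 1)).sub
    (vN_shift _ (ptL_psd (traceF_psd h)).isHermitian (Fintype.card F * Fintype.card S))
  refine ge_of_tendsto hlim ?_
  filter_upwards [self_mem_nhdsWithin] with ε hε
  have hε : 0 < ε := hε
  have e1 := traceF_shift ρ ε
  have e2 := ptL_shift ρ ε
  have e3 := ptL_shift (traceF ρ) (ε * Fintype.card F)
  rw [← e1, mul_assoc] at e3
  have := ssa_posDef (ρ + (ε : ℂ) • 1) (shift_posDef h hε)
    (by rw [e1]; exact shift_posDef (traceF_psd h) (by positivity))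
    (by rw [e2]; exact shift_posDef (ptL_psd h) (by positivity))
    (by rw [e3]; exact shift_posDef (ptL_psd (traceF_psd h)) (by positivity))
  rw [cmiSFgE, e3, e2, e1] at this
  simpa using this

/-- Swap the last two factors. -/
theorem ssa' {S E F : Type*} [Fintype S] [Fintype E] [Fintype F]
    [DecidableEq S] [DecidableEq E] [DecidableEq F] [Nonempty S] [Nonempty E]
    (ρ : Matrix (S × E × F) (S × E × F) ℂ) (h : ρ.PosSemidef) :
    0 ≤ cmiSEgF ρ := by
  have reind : ∀ {n m : Type _} [Fintype n] [DecidableEq n] [Fintype m] [DecidableEq m] (e : n ≃ m)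
      (A : Matrix m m ℂ), A.IsHermitian → vN (A.submatrix e e) = vN A := by
    intro n m _ _ _ _ e A hA
    rw [vN_eq_roots _ hA, vN_eq_roots _ (hA.submatrix e)]
    have := charpoly_reindex e.symm A
    rw [reindex_apply, Equiv.symm_symm] at this
    rw [this]
  have reind' : ∀ {n m : Type _} [Fintype n] [DecidableEq n] [Fintype m] [DecidableEq m] (e : n ≃ m)
      (A : Matrix m m ℂ), A.IsHermitian → vN (A.submatrix e e) = vN A := by
    intro n m _ _ _ _ e A hA
    rw [vN_eq_roots _ hA, vN_eq_roots _ (hA.submatrix e)]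
    have := charpoly_reindex e.symm A
    rw [reindex_apply, Equiv.symm_symm] at this
    rw [this]
  have k := ssa (ρ.submatrix (Equiv.prodCongr (Equiv.refl S) (Equiv.prodComm F E))
    (Equiv.prodCongr (Equiv.refl S) (Equiv.prodComm F E))) (h.submatrix _)
  rw [cmiSFgE, reind _ _ h.isHermitian] at k
  have a1 : traceF (ρ.submatrix (Equiv.prodCongr (Equiv.refl S) (Equiv.prodComm F E))
    (Equiv.prodCongr (Equiv.refl S) (Equiv.prodComm F E))) = traceE ρ := by
    ext x y; simp [traceF, traceE]
  have a2 : ptL (ρ.submatrix (Equiv.prodCongr (Equiv.refl S) (Equiv.prodComm F E))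
    (Equiv.prodCongr (Equiv.refl S) (Equiv.prodComm F E)))
      = (ptL ρ).submatrix (Equiv.prodComm F E) (Equiv.prodComm F E) := by
    ext x y; simp [ptL]
  have a3 : ptL (traceE ρ) = ptL (ptL ρ) := by
    ext x y; simp only [ptL, traceE, of_apply]; rw [Finset.sum_comm]
  rw [a1, a2, a3, reind' _ _ (ptL_psd h).isHermitian] at k
  exact k

theorem MI_sum {S E E' F' : Type*} [Fintype S] [Fintype E] [Fintype E'] [Fintype F']
    [DecidableEq S] [DecidableEq E] [DecidableEq E'] [DecidableEq F']
    (V : Matrix (E' × F') E ℂ) (hV : Vᴴ * V = 1)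
    (σ : Matrix (S × E) (S × E) ℂ) (hσ : σ.PosSemidef) :
    MI (traceF (((1 : Matrix S S ℂ) ⊗ₖ V) * σ * ((1 : Matrix S S ℂ) ⊗ₖ V)ᴴ)) +
      MI (traceE (((1 : Matrix S S ℂ) ⊗ₖ V) * σ * ((1 : Matrix S S ℂ) ⊗ₖ V)ᴴ)) =
    2 * MI σ - cmiSFgE (((1 : Matrix S S ℂ) ⊗ₖ V) * σ * ((1 : Matrix S S ℂ) ⊗ₖ V)ᴴ)
      - cmiSEgF (((1 : Matrix S S ℂ) ⊗ₖ V) * σ * ((1 : Matrix S S ℂ) ⊗ₖ V)ᴴ) := by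
  have b1 := vN_isom ((1 : Matrix S S ℂ) ⊗ₖ V) (kron_isom V hV) σ hσ.isHermitian
  have b2 : ptL (((1 : Matrix S S ℂ) ⊗ₖ V) * σ * ((1 : Matrix S S ℂ) ⊗ₖ V)ᴴ) = V * ptL σ * Vᴴ := by
    rw [conjTranspose_kronecker, conjTranspose_one, ptL_conj]
  have b3 := vN_isom V hV (ptL σ) (ptL_psd hσ).isHermitian
  have b4 := ptR_conj V hV σ
  rw [← b2] at b3
  generalize ((1 : Matrix S S ℂ) ⊗ₖ V) * σ * ((1 : Matrix S S ℂ) ⊗ₖ V)ᴴ = τ at *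
  have a1 : ptR (traceF τ) = ptR τ := by
    ext x y; simp [ptR, traceF, Fintype.sum_prod_type]
  have a2 : ptR (traceE τ) = ptR τ := by
    ext x y; simp only [ptR, traceE, Fintype.sum_prod_type, of_apply]; rw [Finset.sum_comm]
  have a3 : ptL (traceE τ) = ptL (ptL τ) := by
    ext x y; simp only [ptL, traceE, of_apply]; rw [Finset.sum_comm]
  simp only [MI, cmiSFgE, cmiSEgF, a1, a2, a3, b4, b1, b3]
  ring

end aux

/-- If the squashing isometry `W` produces a symmetric quantum Markov chain from `σ_{SE}`
(both conditional mutual informations vanish), then it maximizes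
`I(S;E') + I(S;F')` among all squashing isometries `V`. -/
theorem stmt6 {S E E' F' : Type*} [Fintype S] [Fintype E] [Fintype E'] [Fintype F']
    [DecidableEq S] [DecidableEq E] [DecidableEq E'] [DecidableEq F']
    (V W : Matrix (E' × F') E ℂ) (hV : Vᴴ * V = 1) (hW : Wᴴ * W = 1)
    (σ : Matrix (S × E) (S × E) ℂ) (hσ : IsDensity σ)
    (hMarkov1 : cmiSFgE (((1 : Matrix S S ℂ) ⊗ₖ W) * σ * ((1 : Matrix S S ℂ) ⊗ₖ W)ᴴ) = 0)
    (hMarkov2 : cmiSEgF (((1 : Matrix S S ℂ) ⊗ₖ W) * σ * ((1 : Matrix S S ℂ) ⊗ₖ W)ᴴ) = 0) :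
    MI (traceF (((1 : Matrix S S ℂ) ⊗ₖ V) * σ * ((1 : Matrix S S ℂ) ⊗ₖ V)ᴴ)) +
      MI (traceE (((1 : Matrix S S ℂ) ⊗ₖ V) * σ * ((1 : Matrix S S ℂ) ⊗ₖ V)ᴴ)) ≤
    MI (traceF (((1 : Matrix S S ℂ) ⊗ₖ W) * σ * ((1 : Matrix S S ℂ) ⊗ₖ W)ᴴ)) +
      MI (traceE (((1 : Matrix S S ℂ) ⊗ₖ W) * σ * ((1 : Matrix S S ℂ) ⊗ₖ W)ᴴ)) := by

  have hne : Nonempty (S × E) := by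
    by_contra hcon
    rw [not_nonempty_iff] at hcon
    have := hσ.2
    simp [trace] at this
  obtain ⟨s0, e0⟩ := hne
  have hne2 : Nonempty (E' × F') := by
    by_contra hcon
    rw [not_nonempty_iff] at hcon
    have := congrFun (congrFun hV e0) e0
    simp [Matrix.mul_apply] at this
  obtain ⟨x0, y0⟩ := hne2
  haveI : Nonempty S := ⟨s0⟩
  haveI : Nonempty E' := ⟨x0⟩
  haveI : Nonempty F' := ⟨y0⟩
  rw [MI_sum V hV σ hσ.1, MI_sum W hW σ hσ.1, hMarkov1, hMarkov2]
  have hp := hσ.1.mul_mul_conjTranspose_same ((1 : Matrix S S ℂ) ⊗ₖ V)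
  have h1 := ssa _ hp
  have h2 := ssa' _ hp
  linarith
end

section
/- The function ρ ↦ S(ρ) - S(N^c(ρ)), where N^c is the complementary channel of a quantum channel N (the reverse coherent information functional), is concave in ρ: for any probability weights p_n and states ρ^{(n)}, Σ_n p_n (S(ρ^{(n)}) - S(N^c(ρ^{(n)}))) ≤ S(Σ_n p_n ρ^{(n)}) - S(N^c(Σ_n p_n ρ^{(n)})). -/
open Matrix BigOperators
open scoped Kronecker ComplexOrder

section
set_option linter.unusedSectionVars false
variable {n : Type*} [Fintype n] [DecidableEq n]

lemma exists_spec {A : Matrix n n ℂ} (h : A.IsHermitian) :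
    ∃ U : Matrix n n ℂ, U * Uᴴ = 1 ∧ Uᴴ * U = 1 ∧
      A = U * diagonal (fun i => (h.eigenvalues i : ℂ)) * Uᴴ := by
  refine ⟨h.eigenvectorUnitary, ?_, ?_, ?_⟩
  · exact Unitary.mul_star_self_of_mem h.eigenvectorUnitary.2
  · exact Unitary.star_mul_self_of_mem h.eigenvectorUnitary.2
  · exact h.spectral_theorem

noncomputable def Jf (t : ℝ) (ρ σ X : Matrix n n ℂ) : ℝ :=
  2 * (trace (ρ * X)).re - (trace (σ * (X * Xᴴ))).re - t * (trace (ρ * (Xᴴ * X))).re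

lemma re_trace_nonneg {m : Type*} [Fintype m] [DecidableEq m] {σ : Matrix n n ℂ}
    (hσ : σ.PosSemidef) (Z : Matrix m n ℂ) : 0 ≤ (trace (σ * (Zᴴ * Z))).re := by
  have h := (hσ.mul_mul_conjTranspose_same Z).trace_nonneg
  rw [← Matrix.mul_assoc, Matrix.trace_mul_comm, ← Matrix.mul_assoc]
  exact (Complex.le_def.1 h).1

lemma schwarz {m : Type*} [Fintype m] [DecidableEq m] {k : ℕ} (K : Fin k → Matrix m n ℂ)
    (hK : ∑ i, (K i)ᴴ * K i = 1) {σ : Matrix n n ℂ} (hσ : σ.PosSemidef) (Y : Matrix m m ℂ) :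
    (trace (σ * ((∑ i, (K i)ᴴ * Y * K i) * (∑ i, (K i)ᴴ * Y * K i)ᴴ))).re ≤
      (trace ((∑ i, K i * σ * (K i)ᴴ) * (Y * Yᴴ))).re := by
  set X := ∑ i, (K i)ᴴ * Y * K i with hX
  have hXs : Xᴴ = ∑ i, (K i)ᴴ * Yᴴ * K i := by
    simp [hX, conjTranspose_sum, Matrix.mul_assoc]
  have key : ∑ i, (Yᴴ * K i - K i * Xᴴ)ᴴ * (Yᴴ * K i - K i * Xᴴ) =
      ∑ i, (K i)ᴴ * (Y * Yᴴ) * K i - X * Xᴴ := by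
    have h1 : ∀ i, (Yᴴ * K i - K i * Xᴴ)ᴴ * (Yᴴ * K i - K i * Xᴴ) =
        (K i)ᴴ * (Y * Yᴴ) * K i - ((K i)ᴴ * Y * K i) * Xᴴ - X * ((K i)ᴴ * Yᴴ * K i)
          + X * ((K i)ᴴ * K i) * Xᴴ := by
      intro i
      simp only [conjTranspose_sub, conjTranspose_mul, conjTranspose_conjTranspose,
        Matrix.sub_mul, Matrix.mul_sub, Matrix.mul_assoc]
      abel
    simp only [h1, Finset.sum_add_distrib, Finset.sum_sub_distrib, ← Finset.sum_mul,
      ← Finset.mul_sum, hK, ← hX, ← hXs]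
    simp
  have h0 : 0 ≤ (trace (σ * ∑ i, (Yᴴ * K i - K i * Xᴴ)ᴴ * (Yᴴ * K i - K i * Xᴴ))).re := by
    rw [Finset.mul_sum, trace_sum, Complex.re_sum]
    exact Finset.sum_nonneg fun i _ => re_trace_nonneg hσ _
  rw [key, Matrix.mul_sub, trace_sub, Complex.sub_re] at h0
  have h2 : trace (σ * ∑ i, (K i)ᴴ * (Y * Yᴴ) * K i) =
      trace ((∑ i, K i * σ * (K i)ᴴ) * (Y * Yᴴ)) := by
    rw [Finset.mul_sum, Finset.sum_mul, trace_sum, trace_sum]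
    refine Finset.sum_congr rfl fun i _ => ?_
    rw [← Matrix.mul_assoc, trace_mul_comm]
    simp only [Matrix.mul_assoc]
  rw [← h2]
  linarith

lemma Jf_mono {m : Type*} [Fintype m] [DecidableEq m] {k : ℕ} (K : Fin k → Matrix m n ℂ)
    (hK : ∑ i, (K i)ᴴ * K i = 1) {ρ σ : Matrix n n ℂ} (hρ : ρ.PosSemidef) (hσ : σ.PosSemidef)
    {t : ℝ} (ht : 0 ≤ t) (Y : Matrix m m ℂ) :
    Jf t (∑ i, K i * ρ * (K i)ᴴ) (∑ i, K i * σ * (K i)ᴴ) Y ≤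
      Jf t ρ σ (∑ i, (K i)ᴴ * Y * K i) := by
  have h1 := schwarz K hK hσ Y
  have h2 := schwarz K hK hρ Yᴴ
  have e : ∑ i, (K i)ᴴ * Yᴴ * K i = (∑ i, (K i)ᴴ * Y * K i)ᴴ := by
    simp [conjTranspose_sum, Matrix.mul_assoc]
  rw [e, conjTranspose_conjTranspose, conjTranspose_conjTranspose] at h2
  have h3 : trace ((∑ i, K i * ρ * (K i)ᴴ) * Y) = trace (ρ * ∑ i, (K i)ᴴ * Y * K i) := by
    rw [Finset.mul_sum, Finset.sum_mul, trace_sum, trace_sum]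
    refine Finset.sum_congr rfl fun i _ => ?_
    rw [← Matrix.mul_assoc ρ, trace_mul_comm (ρ * _)]
    simp only [Matrix.mul_assoc]
  unfold Jf
  rw [h3]
  have := mul_le_mul_of_nonneg_left h2 ht
  linarith

lemma Jf_basis (t : ℝ) (U V x : Matrix n n ℂ) (hU : Uᴴ * U = 1) (hV : Vᴴ * V = 1)
    (q s : n → ℝ) :
    Jf t (V * diagonal (fun i => (q i : ℂ)) * Vᴴ) (U * diagonal (fun i => (s i : ℂ)) * Uᴴ)
      (U * x * Vᴴ) =
    ∑ i, ∑ j, (2 * q j * (star ((Uᴴ * V) i j) * x i j).re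
      - (s i + t * q j) * Complex.normSq (x i j)) := by
  have e1 : trace (V * diagonal (fun i => (q i : ℂ)) * Vᴴ * (U * x * Vᴴ)) =
      ∑ i, ∑ j, (q j : ℂ) * (star ((Uᴴ * V) i j) * x i j) := by
    have : V * diagonal (fun i => (q i : ℂ)) * Vᴴ * (U * x * Vᴴ) =
        (V * (diagonal (fun i => (q i : ℂ)) * ((Uᴴ * V)ᴴ * x))) * Vᴴ := by
      simp [Matrix.mul_assoc]
    rw [this, trace_mul_comm, ← Matrix.mul_assoc, hV, Matrix.one_mul, Finset.sum_comm]
    simp only [trace, diag_apply, diagonal_mul]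
    refine Finset.sum_congr rfl fun j _ => ?_
    rw [Matrix.mul_apply, Finset.mul_sum]
    rfl
  have e2 : trace (U * diagonal (fun i => (s i : ℂ)) * Uᴴ * ((U * x * Vᴴ) * (U * x * Vᴴ)ᴴ)) =
      ∑ i, ∑ j, ((s i * Complex.normSq (x i j) : ℝ) : ℂ) := by
    have : U * diagonal (fun i => (s i : ℂ)) * Uᴴ * ((U * x * Vᴴ) * (U * x * Vᴴ)ᴴ) =
        U * (diagonal (fun i => (s i : ℂ)) * ((Uᴴ * U) * (x * ((Vᴴ * V) * xᴴ)))) * Uᴴ := by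
      simp [Matrix.mul_assoc]
    rw [this, trace_mul_comm, ← Matrix.mul_assoc, hV, hU, Matrix.one_mul, Matrix.one_mul,
      Matrix.one_mul]
    simp only [trace, diag_apply, diagonal_mul]
    refine Finset.sum_congr rfl fun j _ => ?_
    rw [Matrix.mul_apply, Finset.mul_sum]
    simp [Complex.mul_conj]
  have e3 : trace (V * diagonal (fun i => (q i : ℂ)) * Vᴴ * ((U * x * Vᴴ)ᴴ * (U * x * Vᴴ))) =
      ∑ i, ∑ j, ((q j * Complex.normSq (x i j) : ℝ) : ℂ) := by
    have : V * diagonal (fun i => (q i : ℂ)) * Vᴴ * ((U * x * Vᴴ)ᴴ * (U * x * Vᴴ)) =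
        V * (diagonal (fun i => (q i : ℂ)) * ((Vᴴ * V) * (xᴴ * ((Uᴴ * U) * x)))) * Vᴴ := by
      simp [Matrix.mul_assoc]
    rw [this, trace_mul_comm, ← Matrix.mul_assoc, hV, hU, Matrix.one_mul, Matrix.one_mul,
      Matrix.one_mul, Finset.sum_comm]
    simp only [trace, diag_apply, diagonal_mul]
    refine Finset.sum_congr rfl fun j _ => ?_
    rw [Matrix.mul_apply, Finset.mul_sum]
    simp [mul_comm _ (x _ _), Complex.mul_conj]
  unfold Jf
  rw [e1, e2, e3]
  simp only [Complex.re_sum, Complex.ofReal_re, Finset.mul_sum, ← Finset.sum_sub_distrib,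
    Complex.re_ofReal_mul]
  refine Finset.sum_congr rfl fun i _ => Finset.sum_congr rfl fun j _ => ?_
  ring

noncomputable def Gf (t : ℝ) (M : Matrix n n ℂ) (q s : n → ℝ) : ℝ :=
  ∑ i, ∑ j, Complex.normSq (M i j) * (q j ^ 2 / (s i + t * q j))

lemma Jf_le_Gf {t : ℝ} (ht : 0 < t) (U V X : Matrix n n ℂ) (hU : Uᴴ * U = 1) (hV : Vᴴ * V = 1)
    (q s : n → ℝ) (hq : ∀ i, 0 ≤ q i) (hs : ∀ i, 0 ≤ s i) :
    Jf t (V * diagonal (fun i => (q i : ℂ)) * Vᴴ) (U * diagonal (fun i => (s i : ℂ)) * Uᴴ) X ≤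
      Gf t (Uᴴ * V) q s := by
  have hU' : U * Uᴴ = 1 := mul_eq_one_comm.1 hU
  have hV' : V * Vᴴ = 1 := mul_eq_one_comm.1 hV
  have hX : X = U * (Uᴴ * X * V) * Vᴴ := by
    calc X = (U * Uᴴ) * X * (V * Vᴴ) := by simp [hU', hV']
      _ = _ := by simp only [Matrix.mul_assoc]
  rw [hX, Jf_basis t U V _ hU hV]
  unfold Gf
  refine Finset.sum_le_sum fun i _ => Finset.sum_le_sum fun j _ => ?_
  generalize (Uᴴ * V) i j = c
  generalize (Uᴴ * X * V) i j = y
  rcases (hq j).eq_or_lt with h0 | h0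
  · rw [← h0]
    have := mul_nonneg (hs i) (Complex.normSq_nonneg y)
    simp; linarith
  · have hd : 0 < s i + t * q j := by have := hs i; positivity
    rw [← mul_div_assoc, le_div_iff₀ hd]
    simp only [Complex.normSq_apply, Complex.mul_re, Complex.star_def, Complex.conj_re,
      Complex.conj_im]
    nlinarith [sq_nonneg ((s i + t * q j) * y.re - q j * c.re),
      sq_nonneg ((s i + t * q j) * y.im - q j * c.im)]

lemma exists_Jf_eq_Gf {t : ℝ} (ht : 0 < t) (U V : Matrix n n ℂ) (hU : Uᴴ * U = 1)
    (hV : Vᴴ * V = 1) (q s : n → ℝ) (hq : ∀ i, 0 ≤ q i) (hs : ∀ i, 0 ≤ s i) :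
    ∃ X, Jf t (V * diagonal (fun i => (q i : ℂ)) * Vᴴ)
      (U * diagonal (fun i => (s i : ℂ)) * Uᴴ) X = Gf t (Uᴴ * V) q s := by
  refine ⟨U * (Matrix.of fun i j => ((q j / (s i + t * q j) : ℝ) : ℂ) * (Uᴴ * V) i j) * Vᴴ, ?_⟩
  rw [Jf_basis t U V _ hU hV]
  unfold Gf
  refine Finset.sum_congr rfl fun i _ => Finset.sum_congr rfl fun j _ => ?_
  rw [Matrix.of_apply]
  generalize (Uᴴ * V) i j = c
  rcases (hq j).eq_or_lt with h0 | h0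
  · rw [← h0]; simp
  · have hd : 0 < s i + t * q j := by have := hs i; positivity
    generalize s i + t * q j = d at hd ⊢
    simp only [Complex.normSq_apply, Complex.mul_re, Complex.star_def, Complex.conj_re,
      Complex.conj_im, Complex.mul_im, Complex.ofReal_re, Complex.ofReal_im]
    field_simp
    ring

lemma der_aux : ∀ {γ : Type _} [Fintype γ] (w q s : γ → ℝ) (_ : ∀ a, w a ≠ 0 → 0 < q a ∧ 0 < s a)
    (t : ℝ) (_ : 0 ≤ t), HasDerivAt (fun t => ∑ a, w a * (Real.log (s a + t * q a)
      - Real.log (s a))) (∑ a, w a * (q a / (s a + t * q a))) t := by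
  intro γ _ w q s h t ht
  refine HasDerivAt.fun_sum fun a _ => ?_
  by_cases hwa : w a = 0
  · simpa [hwa] using hasDerivAt_const t (0 : ℝ)
  · obtain ⟨h1, h2⟩ := h a hwa
    have h3 : HasDerivAt (fun t : ℝ => s a + t * q a) (q a) t := by
      simpa using ((hasDerivAt_id t).mul_const (q a)).const_add (s a)
    exact ((h3.log (by positivity)).sub_const _).const_mul _

lemma lim_aux : ∀ {γ : Type _} [Fintype γ] (w q s : γ → ℝ) (_ : ∀ a, w a ≠ 0 → 0 < q a ∧ 0 < s a),
    Filter.Tendsto (fun t => ∑ a, w a * (Real.log (s a + t * q a)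
      - Real.log (s a)) - (∑ a, w a) * Real.log t) Filter.atTop
      (nhds (∑ a, w a * (Real.log (q a) - Real.log (s a)))) := by
  intro γ _ w q s h
  simp only [Finset.sum_mul, ← Finset.sum_sub_distrib]
  refine tendsto_finsetSum _ fun a _ => ?_
  by_cases hwa : w a = 0
  · simp [hwa]
  · obtain ⟨h1, h2⟩ := h a hwa
    have h3 : Filter.Tendsto (fun t : ℝ => s a / t + q a) Filter.atTop (nhds (q a)) := by
      simpa using (Filter.Tendsto.const_div_atTop Filter.tendsto_id (s a)).add_const (q a)
    have h4 := ((h3.log h1.ne').sub_const (Real.log (s a))).const_mul (w a)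
    refine h4.congr' ?_
    filter_upwards [Filter.eventually_gt_atTop 0] with t ht
    have : s a / t + q a = (s a + t * q a) / t := by field_simp
    rw [this, Real.log_div (by positivity) ht.ne']
    ring

lemma analytic {α β : Type*} [Fintype α] [Fintype β] (w q s : α → ℝ) (w' q' s' : β → ℝ)
    (h : ∀ a, w a ≠ 0 → 0 < q a ∧ 0 < s a) (h' : ∀ a, w' a ≠ 0 → 0 < q' a ∧ 0 < s' a)
    (hw : ∑ a, w a = ∑ a, w' a)
    (hG : ∀ t : ℝ, 0 < t → ∑ a, w' a * (q' a / (s' a + t * q' a)) ≤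
      ∑ a, w a * (q a / (s a + t * q a))) :
    ∑ a, w' a * (Real.log (q' a) - Real.log (s' a)) ≤
      ∑ a, w a * (Real.log (q a) - Real.log (s a)) := by
  have mono : MonotoneOn (fun t => ∑ a, w a * (Real.log (s a + t * q a) - Real.log (s a))
      - ∑ a, w' a * (Real.log (s' a + t * q' a) - Real.log (s' a))) (Set.Ici 0) := by
    have hd : ∀ t : ℝ, 0 ≤ t → HasDerivAt _ _ t := fun t ht =>
      (der_aux w q s h t ht).sub (der_aux w' q' s' h' t ht)
    refine monotoneOn_of_deriv_nonneg (convex_Ici 0) ?_ ?_ ?_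
    · exact fun t ht => (hd t ht).continuousAt.continuousWithinAt
    · intro t ht
      rw [interior_Ici] at ht
      exact (hd t (le_of_lt ht)).differentiableAt.differentiableWithinAt
    · intro t ht
      rw [interior_Ici] at ht
      have := (hd t (le_of_lt ht)).deriv
      have h2 := hG t ht
      refine le_of_le_of_eq ?_ this.symm
      linarith
  refine le_of_tendsto_of_tendsto (lim_aux w' q' s' h') (lim_aux w q s h) ?_
  filter_upwards [Filter.eventually_gt_atTop 0] with t ht
  have := mono (Set.mem_Ici.2 le_rfl) (Set.mem_Ici.2 ht.le) ht.le
  simp at this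
  rw [hw]
  simp only [Finset.sum_sub_distrib, mul_sub] at this ⊢
  linarith

lemma conj_diag (U V : Matrix n n ℂ) (q : n → ℝ) (i : n) :
    (Uᴴ * (V * diagonal (fun i => (q i : ℂ)) * Vᴴ) * U) i i =
      ((∑ j, Complex.normSq ((Uᴴ * V) i j) * q j : ℝ) : ℂ) := by
  have : Uᴴ * (V * diagonal (fun i => (q i : ℂ)) * Vᴴ) * U =
      (Uᴴ * V) * diagonal (fun i => (q i : ℂ)) * (Uᴴ * V)ᴴ := by
    simp [Matrix.mul_assoc]
  rw [this, Matrix.mul_apply]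
  push_cast
  refine Finset.sum_congr rfl fun j _ => ?_
  rw [mul_diagonal, conjTranspose_apply, mul_right_comm]
  simp [Complex.mul_conj]

lemma trace_conj_diag (U : Matrix n n ℂ) (ρ : Matrix n n ℂ) (l : n → ℝ) :
    trace (ρ * (U * diagonal (fun i => (l i : ℂ)) * Uᴴ)) =
      ∑ i, (Uᴴ * ρ * U) i i * l i := by
  rw [← Matrix.mul_assoc, trace_mul_comm, ← Matrix.mul_assoc, ← Matrix.mul_assoc]
  simp [trace, mul_diagonal]

lemma supp {c : ℝ} (hc : 0 < c) (U V : Matrix n n ℂ) (hU : Uᴴ * U = 1)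
    (q s : n → ℝ) (hq : ∀ i, 0 ≤ q i) (hs : ∀ i, 0 ≤ s i)
    (hle : ((U * diagonal (fun i => (s i : ℂ)) * Uᴴ)
      - (c : ℂ) • (V * diagonal (fun i => (q i : ℂ)) * Vᴴ)).PosSemidef) (i j : n)
    (hne : Complex.normSq ((Uᴴ * V) i j) * q j ≠ 0) : 0 < q j ∧ 0 < s i := by
  refine ⟨(hq j).lt_of_ne' (right_ne_zero_of_mul hne), ?_⟩
  have h1 := (hle.conjTranspose_mul_mul_same U).diag_nonneg (i := i)
  rw [Matrix.mul_sub, Matrix.sub_mul, Matrix.sub_apply, Matrix.mul_smul, Matrix.smul_mul,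
    Matrix.smul_apply, conj_diag, conj_diag, hU, smul_eq_mul] at h1
  have h2 := (Complex.le_def.1 h1).1
  have h3 : ∑ j, Complex.normSq ((1 : Matrix n n ℂ) i j) * s j = s i := by
    rw [Finset.sum_eq_single i]
    · simp
    · intro b _ hb; simp [Matrix.one_apply_ne' hb]
    · simp
  rw [h3, Complex.sub_re, Complex.re_ofReal_mul, Complex.ofReal_re, Complex.ofReal_re,
    Complex.zero_re] at h2
  have h4 : ∀ j, 0 ≤ Complex.normSq ((Uᴴ * V) i j) * q j :=
    fun j => mul_nonneg (Complex.normSq_nonneg _) (hq j)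
  have h5 := Finset.single_le_sum (fun j _ => h4 j) (Finset.mem_univ j)
  have h6 := (h4 j).lt_of_ne' hne
  have := mul_pos hc (h6.trans_le h5)
  linarith

lemma sum_col (U V : Matrix n n ℂ) (hU : U * Uᴴ = 1) (hV : Vᴴ * V = 1) (j : n) :
    ∑ i, Complex.normSq ((Uᴴ * V) i j) = 1 := by
  have h : (Uᴴ * V)ᴴ * (Uᴴ * V) = 1 := by
    calc (Uᴴ * V)ᴴ * (Uᴴ * V) = Vᴴ * (U * Uᴴ) * V := by simp [Matrix.mul_assoc]
      _ = 1 := by simp [hU, hV]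
  have h2 := congrFun (congrFun h j) j
  rw [Matrix.mul_apply, Matrix.one_apply_eq] at h2
  have h3 := congrArg Complex.re h2
  rw [Complex.re_sum, Complex.one_re] at h3
  rw [← h3]
  refine Finset.sum_congr rfl fun i _ => ?_
  simp [Complex.normSq_apply]

/-- A logarithm of a Hermitian matrix. -/
lemma exists_log {σ : Matrix n n ℂ} (hσ : σ.PosSemidef) :
    ∃ (U : Matrix n n ℂ) (s : n → ℝ), U * Uᴴ = 1 ∧ Uᴴ * U = 1 ∧ (∀ i, 0 ≤ s i) ∧
      σ = U * diagonal (fun i => (s i : ℂ)) * Uᴴ ∧ vN σ = - ∑ i, s i * Real.log (s i) := by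
  obtain ⟨U, h1, h2, h3⟩ := exists_spec hσ.isHermitian
  exact ⟨U, hσ.isHermitian.eigenvalues, h1, h2, hσ.eigenvalues_nonneg, h3,
    by rw [vN, dif_pos hσ.isHermitian]⟩

/-- Rewriting relative entropy. -/
lemma relent (U V : Matrix n n ℂ) (hU : U * Uᴴ = 1) (hV : Vᴴ * V = 1) (q s : n → ℝ) :
    ∑ a : n × n, (Complex.normSq ((Uᴴ * V) a.1 a.2) * q a.2) *
        (Real.log (q a.2) - Real.log (s a.1)) =
      ∑ j, q j * Real.log (q j) -
      (trace ((V * diagonal (fun i => (q i : ℂ)) * Vᴴ) *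
        (U * diagonal (fun i => (Real.log (s i) : ℂ)) * Uᴴ))).re := by
  rw [trace_conj_diag]
  simp only [conj_diag, mul_sub, Finset.sum_sub_distrib]
  congr 1
  · rw [Fintype.sum_prod_type_right]
    refine Finset.sum_congr rfl fun j _ => ?_
    simp only [← Finset.sum_mul, sum_col U V hU hV, one_mul]
  · rw [Fintype.sum_prod_type, Complex.re_sum]
    refine Finset.sum_congr rfl fun i _ => ?_
    rw [← Complex.ofReal_mul, Complex.ofReal_re, Finset.sum_mul]

lemma sum_weights_s8 (U V : Matrix n n ℂ) (hU : U * Uᴴ = 1) (hV : Vᴴ * V = 1) (q : n → ℝ) :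
    ∑ a : n × n, (Complex.normSq ((Uᴴ * V) a.1 a.2) * q a.2) =
      (trace (V * diagonal (fun i => (q i : ℂ)) * Vᴴ)).re := by
  rw [trace_mul_comm, ← Matrix.mul_assoc, hV, Matrix.one_mul, trace_diagonal,
    Fintype.sum_prod_type_right, Complex.re_sum]
  refine Finset.sum_congr rfl fun j _ => ?_
  simp only [← Finset.sum_mul, sum_col U V hU hV, one_mul, Complex.ofReal_re]

lemma Gf_eq (t : ℝ) (M : Matrix n n ℂ) (q s : n → ℝ) :
    ∑ a : n × n, (Complex.normSq (M a.1 a.2) * q a.2) * (q a.2 / (s a.1 + t * q a.2)) =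
      Gf t M q s := by
  rw [Fintype.sum_prod_type, Gf]
  refine Finset.sum_congr rfl fun i _ => Finset.sum_congr rfl fun j _ => ?_
  ring

lemma channel_psd {m : Type*} [Fintype m] [DecidableEq m] {k : ℕ} (K : Fin k → Matrix m n ℂ)
    {ρ : Matrix n n ℂ} (hρ : ρ.PosSemidef) : (∑ i, K i * ρ * (K i)ᴴ).PosSemidef :=
  posSemidef_sum _ fun i _ => hρ.mul_mul_conjTranspose_same (K i)

lemma channel_trace {m : Type*} [Fintype m] [DecidableEq m] {k : ℕ} (K : Fin k → Matrix m n ℂ)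
    (hK : ∑ i, (K i)ᴴ * K i = 1) (ρ : Matrix n n ℂ) :
    trace (∑ i, K i * ρ * (K i)ᴴ) = trace ρ := by
  have h : trace (ρ * ∑ i, (K i)ᴴ * K i) = trace ρ := by rw [hK, Matrix.mul_one]
  rw [← h, Finset.mul_sum, trace_sum, trace_sum]
  refine Finset.sum_congr rfl fun i _ => ?_
  rw [Matrix.mul_assoc, trace_mul_comm, Matrix.mul_assoc]

/-- Data processing for the relative entropy, for one pair of states. -/
lemma dpi {m : Type*} [Fintype m] [DecidableEq m] {k : ℕ} (K : Fin k → Matrix m n ℂ)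
    (hK : ∑ i, (K i)ᴴ * K i = 1) {c : ℝ} (hc : 0 < c) {ρ σ : Matrix n n ℂ}
    (hρ : ρ.PosSemidef) (hσ : σ.PosSemidef) (hle : (σ - (c : ℂ) • ρ).PosSemidef)
    {U : Matrix n n ℂ} {s : n → ℝ} (hU : U * Uᴴ = 1) (hU' : Uᴴ * U = 1) (hs : ∀ i, 0 ≤ s i)
    (hUσ : σ = U * diagonal (fun i => (s i : ℂ)) * Uᴴ)
    {U₂ : Matrix m m ℂ} {s₂ : m → ℝ} (hU₂ : U₂ * U₂ᴴ = 1) (hU₂' : U₂ᴴ * U₂ = 1)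
    (hs₂ : ∀ i, 0 ≤ s₂ i)
    (hUσ₂ : ∑ i, K i * σ * (K i)ᴴ = U₂ * diagonal (fun i => (s₂ i : ℂ)) * U₂ᴴ) :
    vN ρ - vN (∑ i, K i * ρ * (K i)ᴴ) ≤
      (trace ((∑ i, K i * ρ * (K i)ᴴ) *
        (U₂ * diagonal (fun i => (Real.log (s₂ i) : ℂ)) * U₂ᴴ))).re
      - (trace (ρ * (U * diagonal (fun i => (Real.log (s i) : ℂ)) * Uᴴ))).re := by
  obtain ⟨V, q, hV, hV', hq, hVρ, hvρ⟩ := exists_log hρ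
  obtain ⟨V₂, q₂, hV₂, hV₂', hq₂, hVρ₂, hvρ₂⟩ := exists_log (channel_psd K hρ)
  have hle₂ : ((∑ i, K i * σ * (K i)ᴴ) - (c : ℂ) • (∑ i, K i * ρ * (K i)ᴴ)).PosSemidef := by
    have := channel_psd K hle
    simpa only [Matrix.mul_sub, Matrix.sub_mul, Finset.sum_sub_distrib, Matrix.mul_smul,
      Matrix.smul_mul, ← Finset.smul_sum] using this
  have hA := analytic
    (fun a : n × n => Complex.normSq ((Uᴴ * V) a.1 a.2) * q a.2) (fun a => q a.2) (fun a => s a.1)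
    (fun a : m × m => Complex.normSq ((U₂ᴴ * V₂) a.1 a.2) * q₂ a.2) (fun a => q₂ a.2)
    (fun a => s₂ a.1)
    (fun a ha => supp hc U V hU' q s hq hs (by rw [← hUσ, ← hVρ]; exact hle) a.1 a.2 ha)
    (fun a ha => supp hc U₂ V₂ hU₂' q₂ s₂ hq₂ hs₂ (by rw [← hUσ₂, ← hVρ₂]; exact hle₂)
      a.1 a.2 ha)
    (by
      rw [sum_weights_s8 U V hU hV', sum_weights_s8 U₂ V₂ hU₂ hV₂', ← hVρ, ← hVρ₂,
        channel_trace K hK])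
    (by
      intro t ht
      rw [Gf_eq, Gf_eq]
      obtain ⟨Y, hY⟩ := exists_Jf_eq_Gf ht U₂ V₂ hU₂' hV₂' q₂ s₂ hq₂ hs₂
      rw [← hY, ← hUσ₂, ← hVρ₂]
      refine (Jf_mono K hK hρ hσ ht.le Y).trans ?_
      have := Jf_le_Gf ht U V (∑ i, (K i)ᴴ * Y * K i) hU' hV' q s hq hs
      rwa [← hUσ, ← hVρ] at this)
  rw [relent U V hU hV', relent U₂ V₂ hU₂ hV₂', ← hVρ, ← hVρ₂] at hA
  rw [hvρ, hvρ₂]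
  linarith

lemma trace_log_self (U : Matrix n n ℂ) (s : n → ℝ) (hU' : Uᴴ * U = 1) :
    (trace ((U * diagonal (fun i => (s i : ℂ)) * Uᴴ) *
        (U * diagonal (fun i => (Real.log (s i) : ℂ)) * Uᴴ))).re = ∑ i, s i * Real.log (s i) := by
  have : (U * diagonal (fun i => (s i : ℂ)) * Uᴴ) *
        (U * diagonal (fun i => (Real.log (s i) : ℂ)) * Uᴴ) =
      U * (diagonal (fun i => (s i : ℂ)) * ((Uᴴ * U) *
        diagonal (fun i => (Real.log (s i) : ℂ)))) * Uᴴ := by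
    simp only [Matrix.mul_assoc]
  rw [this, trace_mul_comm, ← Matrix.mul_assoc, hU', Matrix.one_mul, Matrix.one_mul,
    diagonal_mul_diagonal, trace_diagonal, Complex.re_sum]
  refine Finset.sum_congr rfl fun i _ => ?_
  rw [← Complex.ofReal_mul, Complex.ofReal_re]
end

/-- Concavity of the reverse coherent information functional `ρ ↦ S(ρ) - S(N^c(ρ))`,
where the complementary channel `N^c` is given by Kraus operators `K i`. -/
theorem stmt8 {E F : Type*} [Fintype E] [Fintype F] [DecidableEq E] [DecidableEq F]
    (k : ℕ) (K : Fin k → Matrix F E ℂ) (hK : ∑ i, (K i)ᴴ * K i = 1)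
    (m : ℕ) (p : Fin m → ℝ) (hp : ∀ n, 0 ≤ p n) (hps : ∑ n, p n = 1)
    (ρs : Fin m → Matrix E E ℂ) (hρs : ∀ n, IsDensity (ρs n)) :
    ∑ n, p n * (vN (ρs n) - vN (∑ i, K i * ρs n * (K i)ᴴ)) ≤
      vN (∑ n, (p n : ℂ) • ρs n) -
        vN (∑ i, K i * (∑ n, (p n : ℂ) • ρs n) * (K i)ᴴ) := by 
  set σ := ∑ n, (p n : ℂ) • ρs n with hσdef
  have hterm : ∀ n, ((p n : ℂ) • ρs n).PosSemidef := fun n =>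
    (hρs n).1.smul (by exact_mod_cast hp n)
  have hσ : σ.PosSemidef := posSemidef_sum _ fun n _ => hterm n
  obtain ⟨U, s, hU, hU', hs, hUσ, hvσ⟩ := exists_log hσ
  obtain ⟨U₂, s₂, hU₂, hU₂', hs₂, hUσ₂, hvσ₂⟩ := exists_log (channel_psd K hσ)
  set L := U * diagonal (fun i => (Real.log (s i) : ℂ)) * Uᴴ with hL
  set L₂ := U₂ * diagonal (fun i => (Real.log (s₂ i) : ℂ)) * U₂ᴴ with hL₂
  have h1 : ∑ n, p n * (vN (ρs n) - vN (∑ i, K i * ρs n * (K i)ᴴ)) ≤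
      ∑ n, p n * ((trace ((∑ i, K i * ρs n * (K i)ᴴ) * L₂)).re - (trace (ρs n * L)).re) := by
    refine Finset.sum_le_sum fun n _ => ?_
    rcases (hp n).eq_or_lt with h0 | h0
    · simp [← h0]
    · refine mul_le_mul_of_nonneg_left ?_ h0.le
      have hle : (σ - (p n : ℂ) • ρs n).PosSemidef := by
        rw [hσdef, ← Finset.sum_erase_eq_sub (Finset.mem_univ n)]
        exact posSemidef_sum _ fun n _ => hterm n
      exact dpi K hK h0 (hρs n).1 hσ hle hU hU' hs hUσ hU₂ hU₂' hs₂ hUσ₂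
  have h2 : ∑ n, p n * (trace (ρs n * L)).re = - vN σ := by
    rw [hvσ, neg_neg, ← trace_log_self U s hU', ← hUσ, hσdef, Finset.sum_mul, trace_sum,
      Complex.re_sum]
    refine Finset.sum_congr rfl fun n _ => ?_
    rw [Matrix.smul_mul, trace_smul, smul_eq_mul, Complex.re_ofReal_mul]
  have h3 : ∑ n, p n * (trace ((∑ i, K i * ρs n * (K i)ᴴ) * L₂)).re =
      - vN (∑ i, K i * σ * (K i)ᴴ) := by
    have e : ∑ i, K i * σ * (K i)ᴴ = ∑ n, (p n : ℂ) • ∑ i, K i * ρs n * (K i)ᴴ := by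
      simp only [hσdef, Matrix.mul_sum, Matrix.sum_mul, Finset.smul_sum, Matrix.mul_smul,
        Matrix.smul_mul]
      exact Finset.sum_comm
    rw [hvσ₂, neg_neg, ← trace_log_self U₂ s₂ hU₂', ← hUσ₂, e, Finset.sum_mul, trace_sum,
      Complex.re_sum]
    refine Finset.sum_congr rfl fun n _ => ?_
    rw [Matrix.smul_mul, trace_smul, smul_eq_mul, Complex.re_ofReal_mul]
  simp only [mul_sub, Finset.sum_sub_distrib] at h1 ⊢
  linarith
end
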